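/- arXiv:1409.3426 — 7 statements merged into one kernel-verified Lean document; each statement's English description precedes it below -/
import Mathlib

section
/- Let (P_i)_{i∈I} be a cq-graph on a nonempty finite input set I of cardinality a, with output space ℂ^B of dimension b. Then there exists N such that for all n ≥ N, the no-signalling assisted independence number of the n-fold product cq-graph satisfies Υ_n ≥ A({P_i})^n / (4·(n+1)^(a+2b)·(n+b)^(9b²/4)), where Υ_n denotes Υ of the family (P_{i⃗})_{i⃗ : Fin n → I} and the exponent 9b²/4 is taken as a real power. Consequently lim_n (1/n)·log Υ_n = log A({P_i}). -/
open Matrix BigOperators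
open scoped ComplexOrder

noncomputable section

/-- Loewner order: `M ≤ N` iff `N - M` is positive semidefinite. -/
def loe {n : Type*} [Fintype n] (M N : Matrix n n ℂ) : Prop := (N - M).PosSemidef

/-- A projection: Hermitian and idempotent. -/
def IsProj {n : Type*} [Fintype n] (M : Matrix n n ℂ) : Prop := M.IsHermitian ∧ M * M = M

variable {I B : Type*} [Fintype I] [Fintype B] [DecidableEq B]

/-- No-signalling assisted independence number of a cq-graph. -/
def UpsilonCQ (P : I → Matrix B B ℂ) : ℝ :=
  sSup { x : ℝ | ∃ s : I → ℝ, (∀ i, 0 ≤ s i) ∧ x = ∑ i, s i ∧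
    ∃ R : I → Matrix B B ℂ,
      (∀ i, loe 0 (R i) ∧ loe (R i) (s i • ((1 : Matrix B B ℂ) - P i))) ∧
      ∑ i, (s i • P i + R i) = 1 }

/-- Semidefinite packing number of a cq-graph. -/
def AramCQ (P : I → Matrix B B ℂ) : ℝ :=
  sSup { x : ℝ | ∃ s : I → ℝ, (∀ i, 0 ≤ s i) ∧ x = ∑ i, s i ∧
    loe (∑ i, s i • P i) 1 }

/-- The `n`-fold product of a cq-graph. -/
def powCQ (P : I → Matrix B B ℂ) (n : ℕ) :
    (Fin n → I) → Matrix (Fin n → B) (Fin n → B) ℂ :=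
  fun iv => Matrix.of fun b b' => ∏ k, P (iv k) (b k) (b' k)

set_option linter.unusedSectionVars false

section CStar
variable {A J : Type*} [CStarAlgebra A] [PartialOrder A] [StarOrderedRing A] [Fintype J]

lemma key_bound (P : J → A) (hP : ∀ i, IsSelfAdjoint (P i)) (hPP : ∀ i, P i * P i = P i)
    (p : J → ℝ) (hp : ∀ i, 0 ≤ p i) (hp1 : ∑ i, p i = 1)
    (hT : ∑ i, p i • P i ≤ algebraMap ℝ A (1/12)) (X : A) (hX : IsSelfAdjoint X) :
    ‖X - ∑ i, p i • ((1 - P i) * X * (1 - P i))‖ ≤ 5/12 * ‖X‖ := by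
  set T := ∑ i, p i • P i with hTdef
  have hPn : ∀ i, 0 ≤ P i := fun i => by
    have := star_mul_self_nonneg (P i)
    rwa [(hP i).star_eq, hPP] at this
  have hT0 : 0 ≤ T := Finset.sum_nonneg fun i _ => smul_nonneg (hp i) (hPn i)
  have hTn : ‖T‖ ≤ 1/12 := (CStarAlgebra.norm_le_iff_le_algebraMap T (by norm_num) hT0).2 hT
  set m := ‖X‖ with hm
  have hm0 : 0 ≤ m := norm_nonneg _
  have h1 := hX.neg_algebraMap_norm_le_self
  have h2 := hX.le_algebraMap_norm_self
  rw [← hm] at h1 h2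
  set W := ∑ i, p i • (P i * (X + algebraMap ℝ A m) * P i) with hW
  have hW0 : 0 ≤ W := Finset.sum_nonneg fun i _ => smul_nonneg (hp i) (by
    have := (hP i).conjugate_le_conjugate (a := 0) (b := X + algebraMap ℝ A m)
      (by rwa [← sub_nonneg, sub_neg_eq_add] at h1) 
    simpa using this)
  have hW1 : W ≤ (2 * m) • T := by
    rw [hTdef, Finset.smul_sum]
    refine Finset.sum_le_sum fun i _ => ?_
    rw [smul_comm]
    refine smul_le_smul_of_nonneg_left ?_ (hp i)
    have := (hP i).conjugate_le_conjugate (a := X + algebraMap ℝ A m)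
      (b := algebraMap ℝ A (2*m)) (by
        rw [two_mul, map_add]; gcongr)
    refine this.trans_eq ?_
    simp [Algebra.algebraMap_eq_smul_one, hPP]
  have hWn : ‖W‖ ≤ (2 * m) * ‖T‖ := by
    refine (CStarAlgebra.norm_le_norm_of_nonneg_of_le hW0 hW1).trans ?_
    rw [norm_smul, Real.norm_of_nonneg (by positivity)]
  have hWe : W = ∑ i, p i • (P i * X * P i) + m • T := by
    rw [hW, hTdef, Finset.smul_sum, ← Finset.sum_add_distrib]
    refine Finset.sum_congr rfl fun i _ => ?_
    rw [smul_comm m, ← smul_add]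
    simp [Algebra.algebraMap_eq_smul_one, mul_add, add_mul, hPP]
  have e : X - ∑ i, p i • ((1 - P i) * X * (1 - P i)) = T * X + X * T - (W - m • T) := by
    rw [hWe, add_sub_cancel_right]
    have : X = ∑ i, p i • X := by rw [← Finset.sum_smul, hp1, one_smul]
    conv_lhs => rw [this]
    simp only [hTdef]
    rw [Finset.sum_mul, Finset.mul_sum, ← Finset.sum_sub_distrib, ← Finset.sum_add_distrib,
      ← Finset.sum_sub_distrib]
    refine Finset.sum_congr rfl fun i _ => ?_
    rw [← this, smul_mul_assoc, mul_smul_comm, ← smul_add, ← smul_sub, ← smul_sub]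
    congr 1
    noncomm_ring
  rw [e]
  have n1 := norm_sub_le (T * X + X * T) (W - m • T)
  have n2 := norm_add_le (T * X) (X * T)
  have n3 := norm_sub_le W (m • T)
  have n4 := norm_mul_le T X
  have n5 := norm_mul_le X T
  have n6 : ‖m • T‖ = m * ‖T‖ := by rw [norm_smul, Real.norm_of_nonneg hm0]
  nlinarith [norm_nonneg T]

lemma key_solve [FiniteDimensional ℝ A] (P : J → A) (hP : ∀ i, IsSelfAdjoint (P i))
    (hPP : ∀ i, P i * P i = P i)
    (p : J → ℝ) (hp : ∀ i, 0 ≤ p i) (hp1 : ∑ i, p i = 1)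
    (hT : ∑ i, p i • P i ≤ algebraMap ℝ A (1/12)) (Y : A) (hY : IsSelfAdjoint Y)
    (hYn : ‖Y‖ ≤ 1/4) :
    ∃ X : A, IsSelfAdjoint X ∧ -1 ≤ X ∧ X ≤ 1 ∧ ∑ i, p i • ((1 - P i) * X * (1 - P i)) = Y := by
  let V := selfAdjoint.submodule ℝ A
  let L0 : A →ₗ[ℝ] A := ∑ i, p i • (LinearMap.mulRight ℝ (1 - P i) ∘ₗ LinearMap.mulLeft ℝ (1 - P i))
  have hL0 : ∀ X, L0 X = ∑ i, p i • ((1 - P i) * X * (1 - P i)) := fun X => by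
    simp [L0, LinearMap.sum_apply]
  have hmem : ∀ X ∈ V, L0 X ∈ V := fun X hX => by
    rw [hL0]
    refine Submodule.sum_mem _ fun i _ => Submodule.smul_mem _ _ ?_
    have hX' : IsSelfAdjoint X := hX
    have hq : IsSelfAdjoint (1 - P i) := (IsSelfAdjoint.one A).sub (hP i)
    have := hX'.conjugate (1 - P i)
    rw [hq.star_eq] at this
    exact this
  let L : V →ₗ[ℝ] V := L0.restrict hmem
  have hinj : Function.Injective L := by
    rw [injective_iff_map_eq_zero]
    intro X hX
    have h0 : L0 X.1 = 0 := congrArg Subtype.val hX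
    have := key_bound P hP hPP p hp hp1 hT X.1 X.2
    rw [← hL0, h0, sub_zero] at this
    have : ‖X.1‖ = 0 := by nlinarith [norm_nonneg X.1]
    exact Subtype.ext (norm_eq_zero.1 this)
  obtain ⟨X, hX⟩ := (LinearMap.injective_iff_surjective.1 hinj) ⟨Y, hY⟩
  have hX0 : L0 X.1 = Y := congrArg Subtype.val hX
  have hs : IsSelfAdjoint X.1 := X.2
  have hb := key_bound P hP hPP p hp hp1 hT X.1 X.2
  rw [← hL0, hX0] at hb
  have hn : ‖X.1‖ ≤ 1 := by
    have := norm_sub_norm_le X.1 Y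
    linarith
  have h3 : algebraMap ℝ A ‖X.1‖ ≤ 1 := by
    rw [← map_one (algebraMap ℝ A)]; gcongr
  exact ⟨X.1, X.2, (neg_le_neg h3).trans hs.neg_algebraMap_norm_le_self,
    hs.le_algebraMap_norm_self.trans h3, by rw [← hL0, hX0]⟩

lemma key_main [FiniteDimensional ℝ A] (P : J → A) (hP : ∀ i, IsSelfAdjoint (P i))
    (hPP : ∀ i, P i * P i = P i)
    (s : J → ℝ) (hs : ∀ i, 0 ≤ s i) (hx : 12 ≤ ∑ i, s i) (hS : ∑ i, s i • P i ≤ 1) :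
    ∃ R : J → A, (∀ i, 0 ≤ R i ∧ R i ≤ (s i / 4) • (1 - P i)) ∧
      ∑ i, ((s i / 4) • P i + R i) = 1 := by
  set x := ∑ i, s i with hxdef
  have hx0 : 0 < x := by linarith
  have hPn : ∀ i, 0 ≤ P i := fun i => by
    have := star_mul_self_nonneg (P i)
    rwa [(hP i).star_eq, hPP] at this
  set S := ∑ i, s i • P i with hSdef
  have hS0 : 0 ≤ S := Finset.sum_nonneg fun i _ => smul_nonneg (hs i) (hPn i)
  have hSn : ‖S‖ ≤ 1 := (CStarAlgebra.norm_le_one_iff_of_nonneg S hS0).2 hS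
  have hc : 0 ≤ 1/4 - 1/x ∧ 1/4 - 1/x ≤ 1/4 := by
    have : 1/x ≤ 1/12 := one_div_le_one_div_of_le (by norm_num) hx
    have : 0 < 1/x := by positivity
    constructor <;> linarith
  have hTe : ∑ i, (s i / x) • P i = (1/x) • S := by
    rw [hSdef, Finset.smul_sum]
    refine Finset.sum_congr rfl fun i _ => ?_
    rw [smul_smul]; congr 1; ring
  have hp1 : ∑ i, s i / x = 1 := by rw [← Finset.sum_div, ← hxdef, div_self hx0.ne']
  obtain ⟨X, hX, hX1, hX2, hXe⟩ := key_solve P hP hPP (fun i => s i / x)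
    (fun i => div_nonneg (hs i) hx0.le) hp1 (by
      rw [hTe, Algebra.algebraMap_eq_smul_one]
      calc (1/x) • S ≤ (1/x) • (1:A) := smul_le_smul_of_nonneg_left hS (by positivity)
        _ ≤ _ := smul_le_smul_of_nonneg_right (one_div_le_one_div_of_le (by norm_num) hx)
                  zero_le_one) ((1/4 - 1/x) • S)
    (IsSelfAdjoint.of_nonneg (smul_nonneg hc.1 hS0)) (by
      rw [norm_smul, Real.norm_of_nonneg hc.1]
      nlinarith [norm_nonneg S])
  have hq : ∀ i, IsSelfAdjoint (1 - P i) := fun i => (IsSelfAdjoint.one A).sub (hP i)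
  have hqq : ∀ i, (1 - P i) * (1 - P i) = 1 - P i := fun i => by
    rw [mul_sub, sub_mul, sub_mul, hPP i]; simp
  refine ⟨fun i => (s i / x) • ((1 - P i) * (1 - X) * (1 - P i)), fun i => ⟨?_, ?_⟩, ?_⟩
  · refine smul_nonneg (div_nonneg (hs i) hx0.le) ?_
    have := (hq i).conjugate_le_conjugate (sub_nonneg.2 hX2)
    simpa using this
  · have hqn : 0 ≤ 1 - P i := by
      have := star_mul_self_nonneg (1 - P i)
      rwa [(hq i).star_eq, hqq] at this
    have := (hq i).conjugate_le_conjugate (a := 1 - X) (b := (2:ℝ) • 1)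
      (by rw [two_smul, sub_le_iff_le_add, add_assoc]
          nth_rewrite 1 [← add_zero (1:A)]
          gcongr
          rw [← neg_le_iff_add_nonneg']; exact hX1)
    calc _ ≤ (s i / x) • ((2:ℝ) • (1 - P i)) := by
            refine smul_le_smul_of_nonneg_left (this.trans_eq ?_) (div_nonneg (hs i) hx0.le)
            simp [hqq]
      _ ≤ _ := by
            rw [smul_smul]
            refine smul_le_smul_of_nonneg_right ?_ hqn
            rw [div_mul_eq_mul_div, div_le_div_iff₀ hx0 (by norm_num)]
            nlinarith [hs i]
  · have : ∀ i, (s i / 4) • P i + (s i / x) • ((1 - P i) * (1 - X) * (1 - P i)) =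
       (1/4:ℝ) • (s i • P i) + ((s i / x) • 1 - (s i / x) • P i
         - (s i / x) • ((1 - P i) * X * (1 - P i))) := fun i => by
      rw [mul_sub (1 - P i), mul_one, sub_mul ((1 - P i)), hqq, smul_sub, smul_sub, smul_smul]
      congr 2; ring
    simp only [this]
    rw [Finset.sum_add_distrib, Finset.sum_sub_distrib, Finset.sum_sub_distrib, hXe, hTe,
      ← Finset.sum_smul, hp1, ← Finset.smul_sum, ← hSdef, sub_smul]
    simp
end CStar

section Mat
variable {J C : Type*} [Fintype J] [Fintype C] [DecidableEq C]

open scoped MatrixOrder Matrix.Norms.L2Operator in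
lemma oneshot (P : J → Matrix C C ℂ) (hP : ∀ i, IsProj (P i)) (s : J → ℝ) (hs : ∀ i, 0 ≤ s i)
    (hx : 12 ≤ ∑ i, s i) (hS : loe (∑ i, s i • P i) 1) :
    ∃ R : J → Matrix C C ℂ,
      (∀ i, loe 0 (R i) ∧ loe (R i) ((s i / 4) • ((1 : Matrix C C ℂ) - P i))) ∧
      ∑ i, ((s i / 4) • P i + R i) = 1 := by
  have hfd : FiniteDimensional ℝ (Matrix C C ℂ) := inferInstance
  exact key_main P (fun i => (hP i).1) (fun i => (hP i).2) s hs hx hS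

lemma IsProj.psd {P : Matrix C C ℂ} (h : IsProj P) : P.PosSemidef := by
  have := Matrix.posSemidef_conjTranspose_mul_self P
  rwa [h.1.eq, h.2] at this

lemma IsProj.compl {P : Matrix C C ℂ} (h : IsProj P) : IsProj (1 - P) := by
  refine ⟨Matrix.isHermitian_one.sub h.1, ?_⟩
  rw [mul_sub, sub_mul, sub_mul, h.2]; simp

lemma psd_smul {M : Matrix C C ℂ} (h : M.PosSemidef) {r : ℝ} (hr : 0 ≤ r) :
    (r • M).PosSemidef := by
  exact h.smul hr

lemma psd_sum {f : J → Matrix C C ℂ} (h : ∀ i, (f i).PosSemidef) : (∑ i, f i).PosSemidef :=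
  Matrix.posSemidef_sum _ fun i _ => h i

/-- feasible set for packing -/
def ASet (P : J → Matrix C C ℂ) : Set ℝ := { x : ℝ | ∃ s : J → ℝ, (∀ i, 0 ≤ s i) ∧ x = ∑ i, s i ∧
    loe (∑ i, s i • P i) 1 }

/-- feasible set for upsilon -/
def USet (P : J → Matrix C C ℂ) : Set ℝ := { x : ℝ | ∃ s : J → ℝ, (∀ i, 0 ≤ s i) ∧ x = ∑ i, s i ∧
    ∃ R : J → Matrix C C ℂ,
      (∀ i, loe 0 (R i) ∧ loe (R i) (s i • ((1 : Matrix C C ℂ) - P i))) ∧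
      ∑ i, (s i • P i + R i) = 1 }

lemma USet_subset (P : J → Matrix C C ℂ) : USet P ⊆ ASet P := by
  rintro x ⟨s, hs, hx, R, hR, h1⟩
  refine ⟨s, hs, hx, ?_⟩
  unfold loe
  rw [← h1, Finset.sum_add_distrib, add_sub_cancel_left]
  exact psd_sum fun i => by simpa [loe] using (hR i).1

lemma one_mem_USet (P : J → Matrix C C ℂ) (hP : ∀ i, IsProj (P i)) [Nonempty J] :
    (1:ℝ) ∈ USet P := by
  classical
  obtain ⟨j⟩ := ‹Nonempty J›
  refine ⟨fun i => if i = j then 1 else 0, fun i => by dsimp only; split_ifs <;> norm_num, by simp,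
    fun i => (if i = j then (1:ℝ) else 0) • (1 - P i), fun i => ⟨?_, ?_⟩, ?_⟩
  · unfold loe
    rw [sub_zero]
    exact psd_smul (hP i).compl.psd (by split_ifs <;> norm_num)
  · unfold loe
    rw [sub_self]; exact Matrix.PosSemidef.zero
  · simp only [← smul_add]
    simp

lemma quarter_mem (P : J → Matrix C C ℂ) (hP : ∀ i, IsProj (P i)) {x : ℝ} (hx : x ∈ ASet P)
    (h12 : 12 ≤ x) : x / 4 ∈ USet P := by
  obtain ⟨s, hs, rfl, h⟩ := hx
  obtain ⟨R, hR, h1⟩ := oneshot P hP s hs h12 h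
  exact ⟨fun i => s i / 4, fun i => by have := hs i; positivity, by rw [Finset.sum_div], R, hR, h1⟩

lemma ASet_bdd (P : J → Matrix C C ℂ) (hP : ∀ i, IsProj (P i)) (h0 : ∀ i, P i ≠ 0) :
    BddAbove (ASet P) := by
  refine ⟨∑ i : J, 1, ?_⟩
  rintro x ⟨s, hs, rfl, h⟩
  refine Finset.sum_le_sum fun i _ => ?_
  classical
  have e : (1 - s i • P i).PosSemidef := by
    have e2 : 1 - s i • P i = (1 - ∑ i, s i • P i) + ∑ j, if j = i then 0 else s j • P j := by
      have : ∑ i, s i • P i = ∑ j, ((if j = i then 0 else s j • P j) + if j = i then s j • P j else 0) := by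
        refine Finset.sum_congr rfl fun j _ => ?_
        split_ifs <;> simp
      rw [this, Finset.sum_add_distrib, Finset.sum_ite_eq' Finset.univ i]
      simp only [Finset.mem_univ, if_true]
      abel
    rw [e2]
    refine Matrix.PosSemidef.add h (psd_sum fun j => ?_)
    split_ifs
    · exact Matrix.PosSemidef.zero
    · exact psd_smul (hP j).psd (hs j)
  have e3 := e.conjTranspose_mul_mul_same (P i)
  have e4 : (P i)ᴴ * (1 - s i • P i) * P i = (1 - s i) • P i := by
    rw [(hP i).1.eq, mul_sub, sub_mul]
    simp [(hP i).2, sub_smul]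
  rw [e4] at e3
  have t1 := e3.trace_nonneg
  have t2 := (hP i).psd.trace_nonneg
  have t3 : (P i).trace ≠ 0 := fun h => h0 i ((hP i).psd.trace_eq_zero_iff.1 h)
  rw [Matrix.trace_smul, Complex.le_def] at t1
  rw [Complex.le_def] at t2
  have t4 : 0 < (P i).trace.re := lt_of_le_of_ne t2.1 (fun h => t3 (Complex.ext h.symm t2.2.symm))
  have := t1.1
  simp at this
  nlinarith

lemma scale (P : J → Matrix C C ℂ) (hb : BddAbove (ASet P)) (t : J → ℝ) (ht : ∀ i, 0 ≤ t i)
    {d : ℝ} (hd : 0 < d) (h : loe (∑ i, t i • P i) (d • (1 : Matrix C C ℂ))) :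
    ∑ i, t i ≤ d * sSup (ASet P) := by
  have : (∑ i, t i) / d ∈ ASet P := by
    refine ⟨fun i => t i / d, fun i => div_nonneg (ht i) hd.le, by rw [Finset.sum_div], ?_⟩
    have := psd_smul h (inv_nonneg.2 hd.le)
    unfold loe
    convert this using 1
    rw [smul_sub, smul_smul, inv_mul_cancel₀ hd.ne', one_smul, Finset.smul_sum]
    congr 1
    refine Finset.sum_congr rfl fun i _ => ?_
    rw [smul_smul]; congr 1; ring
  have := le_csSup hb this
  rwa [div_le_iff₀' hd] at this

end Mat

section Tensor
variable {J C D : Type*} [Fintype J] [Fintype C] [DecidableEq C] [Fintype D] [DecidableEq D]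

/-- compression isometry -/
def compV (C : Type*) [DecidableEq C] {D : Type*} (v : D → ℂ) : Matrix (C × D) C ℂ :=
  Matrix.of fun x c => if x.1 = c then v x.2 else 0

lemma compV_kron (v : D → ℂ) (M : Matrix C C ℂ) (N : Matrix D D ℂ) :
    (compV C v)ᴴ * (Matrix.kroneckerMap (· * ·) M N) * compV C v = (star v ⬝ᵥ N *ᵥ v) • M := by
  ext x y
  simp only [Matrix.mul_apply, compV, Matrix.conjTranspose_apply, Matrix.of_apply,
    Fintype.sum_prod_type, Matrix.kroneckerMap_apply, Matrix.smul_apply, dotProduct, mulVec,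
    smul_eq_mul, Pi.star_apply, Finset.sum_mul, Finset.mul_sum, apply_ite star, star_zero,
    ite_mul, mul_ite, zero_mul, mul_zero]
  simp only [Finset.sum_ite_irrel, Finset.sum_const_zero, Finset.sum_ite_eq', Finset.mem_univ, if_true]
  rw [Finset.sum_comm]
  refine Finset.sum_congr rfl fun c _ => ?_
  refine Finset.sum_congr rfl fun d _ => ?_
  simp
  ring
end Tensor

lemma powCQ_cons (P : I → Matrix B B ℂ) (n : ℕ) (x : I × (Fin n → I)) :
    (powCQ P (n+1) (Fin.consEquiv (fun _ => I) x)).submatrix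
      (Fin.consEquiv (fun _ => B)) (Fin.consEquiv (fun _ => B)) =
    Matrix.kroneckerMap (· * ·) (P x.1) (powCQ P n x.2) := by
  ext b b'
  simp [powCQ, Fin.prod_univ_succ, Fin.consEquiv]

lemma powCQ_proj (P : I → Matrix B B ℂ) (hP : ∀ i, IsProj (P i)) (n : ℕ) (w : Fin n → I) :
    IsProj (powCQ P n w) := by
  constructor
  · ext b b'
    simp only [powCQ, Matrix.conjTranspose_apply, Matrix.of_apply, star_prod]
    exact Finset.prod_congr rfl fun k _ => (hP (w k)).1.apply _ _
  · ext b b'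
    simp only [powCQ, Matrix.mul_apply, Matrix.of_apply, ← Finset.prod_mul_distrib]
    have h := Finset.prod_univ_sum (fun _ : Fin n => (Finset.univ : Finset B))
      (fun k c => P (w k) (b k) c * P (w k) c (b' k))
    rw [Fintype.piFinset_univ] at h
    rw [← h]
    refine Finset.prod_congr rfl fun k _ => ?_
    rw [← Matrix.mul_apply, (hP (w k)).2]

lemma pow_mem_ASet (P : I → Matrix B B ℂ) (hP : ∀ i, IsProj (P i)) {x : ℝ} (hx : x ∈ ASet P) (n : ℕ) :
    x ^ n ∈ ASet (powCQ P n) := by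
  obtain ⟨s, hs, rfl, h⟩ := hx
  refine ⟨fun w => ∏ k, s (w k), fun w => Finset.prod_nonneg fun k _ => hs _, ?_, ?_⟩
  · have h := Finset.prod_univ_sum (fun _ : Fin n => (Finset.univ : Finset I)) (fun k i => s i)
    rw [Fintype.piFinset_univ] at h
    rw [← h]; simp
  · induction n with
    | zero =>
      unfold loe
      have : (1 - ∑ w : Fin 0 → I, (∏ k, s (w k)) • powCQ P 0 w) = 0 := by
        ext b b'
        have : b = b' := Subsingleton.elim _ _
        simp [powCQ, this]
      rw [this]; exact Matrix.PosSemidef.zero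
    | succ n ih =>
      unfold loe at *
      rw [← Matrix.posSemidef_submatrix_equiv (Fin.consEquiv (fun _ => B))]
      set T := ∑ w : Fin n → I, (∏ k, s (w k)) • powCQ P n w with hT
      set S := ∑ i, s i • P i with hS
      have hSp : S.PosSemidef := psd_sum fun i => psd_smul (hP i).psd (hs i)
      have e : (1 - ∑ w : Fin (n+1) → I, (∏ k, s (w k)) • powCQ P (n+1) w).submatrix
          (Fin.consEquiv (fun _ => B)) (Fin.consEquiv (fun _ => B)) =
          Matrix.kroneckerMap (· * ·) (1 - S) (1 : Matrix (Fin n → B) (Fin n → B) ℂ) +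
          Matrix.kroneckerMap (· * ·) S (1 - T) := by
        have e1 : (∑ w : Fin (n+1) → I, (∏ k, s (w k)) • powCQ P (n+1) w).submatrix
          (Fin.consEquiv (fun _ => B)) (Fin.consEquiv (fun _ => B)) =
          Matrix.kroneckerMap (· * ·) S T := by
          rw [← Equiv.sum_comp (Fin.consEquiv (fun _ => I))]
          ext b b'
          simp only [Matrix.submatrix_apply, Matrix.sum_apply, Matrix.kroneckerMap_apply, hS, hT,
            Finset.sum_mul_sum, Fintype.sum_prod_type, Matrix.smul_apply]
          refine Finset.sum_congr rfl fun i _ => Finset.sum_congr rfl fun w _ => ?_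
          have := congrFun (congrFun (powCQ_cons P n (i, w)) b) b'
          simp only [Matrix.submatrix_apply, Matrix.kroneckerMap_apply] at this
          rw [this]
          simp [Fin.prod_univ_succ, Fin.consEquiv]
          ring
        have e0 : (1 : Matrix (Fin (n+1) → B) (Fin (n+1) → B) ℂ).submatrix
          (Fin.consEquiv (fun _ => B)) (Fin.consEquiv (fun _ => B)) =
          Matrix.kroneckerMap (· * ·) (1 : Matrix B B ℂ) (1 : Matrix (Fin n → B) (Fin n → B) ℂ) := by
          rw [Matrix.submatrix_one_equiv]; exact Matrix.one_kronecker_one.symm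
        rw [Matrix.submatrix_sub, Pi.sub_apply, Pi.sub_apply, e1, e0]
        ext b b'
        simp only [Matrix.sub_apply, Matrix.add_apply, Matrix.kroneckerMap_apply]
        ring
      rw [e]
      exact (Matrix.PosSemidef.kronecker h Matrix.PosSemidef.one).add
        (Matrix.PosSemidef.kronecker hSp ih)

lemma submult (P : I → Matrix B B ℂ) (hP : ∀ i, IsProj (P i)) (hb : BddAbove (ASet P))
    (hA : 0 < sSup (ASet P)) (n : ℕ) : ∀ (c : ℝ), 0 < c → ∀ s : (Fin n → I) → ℝ, (∀ w, 0 ≤ s w) →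
    loe (∑ w, s w • powCQ P n w) (c • (1 : Matrix (Fin n → B) (Fin n → B) ℂ)) →
    ∑ w, s w ≤ c * sSup (ASet P) ^ n := by
  set A := sSup (ASet P) with hAdef
  induction n with
  | zero =>
    intro c hc s hs h
    have := h.diag_nonneg (i := Fin.elim0)
    simp only [Matrix.sub_apply, Matrix.smul_apply, Matrix.sum_apply, powCQ, Matrix.of_apply] at this
    simp only [Complex.le_def] at this
    simpa using this.1
  | succ n ih =>
    intro c hc s hs h
    let e := Fin.consEquiv (n := n) (fun _ => I)
    have key : loe (∑ w, (∑ i, s (e (i, w))) • powCQ P n w)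
        ((c * A) • (1 : Matrix (Fin n → B) (Fin n → B) ℂ)) := by
      have hpn := fun w => (powCQ_proj P hP n w).psd
      refine Matrix.PosSemidef.of_dotProduct_mulVec_nonneg ?_ ?_
      · refine Matrix.IsHermitian.sub (psd_smul Matrix.PosSemidef.one (by positivity)).1
          (psd_sum fun w => psd_smul (hpn w) (Finset.sum_nonneg fun i _ => hs _)).1
      intro v
      by_cases hv : v = 0
      · simp [hv]
      have hq : ∀ w, ∃ r : ℝ, 0 ≤ r ∧ star v ⬝ᵥ (powCQ P n w) *ᵥ v = (r : ℂ) := fun w => by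
        have h1 := (hpn w).dotProduct_mulVec_nonneg v
        rw [Complex.le_def] at h1
        exact ⟨_, h1.1, Complex.ext rfl h1.2.symm⟩
      choose q hq0 hq using hq
      obtain ⟨d, hd, hdv⟩ : ∃ d : ℝ, 0 < d ∧ star v ⬝ᵥ v = (d : ℂ) := by
        have h1 : 0 < star v ⬝ᵥ v := Matrix.dotProduct_star_self_pos_iff.2 hv
        rw [Complex.lt_def] at h1
        exact ⟨_, h1.1, Complex.ext rfl h1.2.symm⟩
      have h2 := ((Matrix.posSemidef_submatrix_equiv (Fin.consEquiv (fun _ => B))).2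
        h).conjTranspose_mul_mul_same (compV B v)
      have e0 : (1 : Matrix (Fin (n+1) → B) (Fin (n+1) → B) ℂ).submatrix
          (Fin.consEquiv (fun _ => B)) (Fin.consEquiv (fun _ => B)) =
          Matrix.kroneckerMap (· * ·) (1 : Matrix B B ℂ) (1 : Matrix (Fin n → B) (Fin n → B) ℂ) := by
        rw [Matrix.submatrix_one_equiv]; exact Matrix.one_kronecker_one.symm
      have e1 : (c • (1 : Matrix (Fin (n+1) → B) (Fin (n+1) → B) ℂ)
          - ∑ w, s w • powCQ P (n+1) w).submatrix
          (Fin.consEquiv (fun _ => B)) (Fin.consEquiv (fun _ => B)) =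
          c • Matrix.kroneckerMap (· * ·) (1 : Matrix B B ℂ) (1 : Matrix (Fin n → B) (Fin n → B) ℂ)
          - ∑ i, ∑ w, s (e (i, w)) • Matrix.kroneckerMap (· * ·) (P i) (powCQ P n w) := by
        rw [← e0, ← Equiv.sum_comp e, Fintype.sum_prod_type]
        ext b b'
        simp only [Matrix.submatrix_apply, Matrix.sub_apply, Matrix.sum_apply, Matrix.smul_apply]
        congr 1
        refine Finset.sum_congr rfl fun i _ => Finset.sum_congr rfl fun w _ => ?_
        have := congrFun (congrFun (powCQ_cons P n (i, w)) b) b'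
        rw [← this]; rfl
      rw [e1] at h2
      have e2 : (compV B v)ᴴ * (c • Matrix.kroneckerMap (· * ·) (1 : Matrix B B ℂ)
          (1 : Matrix (Fin n → B) (Fin n → B) ℂ)
          - ∑ i, ∑ w, s (e (i, w)) • Matrix.kroneckerMap (· * ·) (P i) (powCQ P n w)) * compV B v
          = (c * d) • (1 : Matrix B B ℂ) - ∑ i, (∑ w, s (e (i, w)) * q w) • P i := by
        rw [Matrix.mul_sub, Matrix.sub_mul]
        simp only [Matrix.mul_sum, Matrix.sum_mul, Matrix.mul_smul, Matrix.smul_mul, compV_kron, hq,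
          Matrix.one_mulVec, hdv, Finset.sum_smul, mul_smul]
        rfl
      rw [e2] at h2
      have h3 := scale P hb (fun i => ∑ w, s (e (i, w)) * q w)
        (fun i => Finset.sum_nonneg fun w _ => mul_nonneg (hs _) (hq0 w)) (mul_pos hc hd) h2
      have e3 : star v ⬝ᵥ ((c * A) • (1 : Matrix (Fin n → B) (Fin n → B) ℂ)
          - ∑ w, (∑ i, s (e (i, w))) • powCQ P n w) *ᵥ v
          = ((c * d * A - ∑ i, ∑ w, s (e (i, w)) * q w : ℝ) : ℂ) := by
        rw [Matrix.sub_mulVec, dotProduct_sub, Matrix.sum_mulVec, dotProduct_sum]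
        simp only [Matrix.smul_mulVec, dotProduct_smul, hq, Matrix.one_mulVec, hdv]
        rw [Finset.sum_comm]
        simp only [Complex.real_smul]
        push_cast
        simp only [Finset.sum_mul]
        ring
      rw [e3]
      exact_mod_cast sub_nonneg.2 h3
    have := ih (c * A) (by positivity) _ (fun w => Finset.sum_nonneg fun i _ => hs _) key
    rw [← Equiv.sum_comp e, Fintype.sum_prod_type, Finset.sum_comm]
    calc _ ≤ _ := this
      _ = _ := by ring

lemma U_unbdd (P : I → Matrix B B ℂ) (i : I) (h : P i = 0) : ¬ BddAbove (USet P) := by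
  classical
  rintro ⟨M, hM⟩
  have : max 1 (M + 1) ∈ USet P := by
    refine ⟨fun j => if j = i then max 1 (M+1) else 0, fun j => ?_, by simp,
      fun j => if j = i then 1 else 0, fun j => ⟨?_, ?_⟩, ?_⟩
    · dsimp only; split_ifs <;> simp
    · unfold loe; dsimp only; split_ifs
      · simpa using Matrix.PosSemidef.one
      · simpa using Matrix.PosSemidef.zero
    · unfold loe
      by_cases hj : j = i
      · subst hj
        have : (max 1 (M+1)) • (1 : Matrix B B ℂ) - 1 = (max 1 (M+1) - 1) • (1 : Matrix B B ℂ) := by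
          rw [sub_smul, one_smul]
        simp only [h, if_true, sub_zero]
        rw [this]
        exact psd_smul Matrix.PosSemidef.one (by simp)
      · simpa [hj] using Matrix.PosSemidef.zero
    · rw [Finset.sum_add_distrib]
      simp [h]
  have := hM this
  have := le_max_right 1 (M+1)
  linarith

lemma lower {n : ℕ} (P : I → Matrix B B ℂ) (hP : ∀ i, IsProj (P i)) [Nonempty I]
    (hb : BddAbove (USet (powCQ P n))) {x : ℝ} (hx : x ∈ ASet P) :
    x ^ n ≤ 12 * sSup (USet (powCQ P n)) := by
  have h1 := le_csSup hb (one_mem_USet (powCQ P n) (powCQ_proj P hP n))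
  by_cases h : 12 ≤ x ^ n
  · have := le_csSup hb (quarter_mem (powCQ P n) (powCQ_proj P hP n) (pow_mem_ASet P hP hx n) h)
    linarith
  · linarith

lemma main_bounds [Nonempty I] (P : I → Matrix B B ℂ) (hP : ∀ i, IsProj (P i))
    (h0 : ∀ i, P i ≠ 0) (n : ℕ) :
    1 ≤ AramCQ P ∧ AramCQ P ^ n ≤ 12 * UpsilonCQ (powCQ P n) ∧
      UpsilonCQ (powCQ P n) ≤ AramCQ P ^ n ∧ 1 ≤ UpsilonCQ (powCQ P n) := by
  change 1 ≤ sSup (ASet P) ∧ sSup (ASet P) ^ n ≤ 12 * sSup (USet (powCQ P n)) ∧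
      sSup (USet (powCQ P n)) ≤ sSup (ASet P) ^ n ∧ 1 ≤ sSup (USet (powCQ P n))
  have hb := ASet_bdd P hP h0
  have h1 : 1 ≤ sSup (ASet P) := le_csSup hb (USet_subset P (one_mem_USet P hP))
  have hU : ∀ y ∈ USet (powCQ P n), y ≤ sSup (ASet P) ^ n := by
    intro y hy
    obtain ⟨s, hs, rfl, h⟩ := USet_subset _ hy
    have := submult P hP hb (by linarith) n 1 one_pos s hs (by rwa [one_smul])
    rwa [one_mul] at this
  have hbU : BddAbove (USet (powCQ P n)) := ⟨_, hU⟩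
  have hm := one_mem_USet (powCQ P n) (powCQ_proj P hP n)
  have hU1 := le_csSup hbU hm
  refine ⟨h1, ?_, csSup_le ⟨_, hm⟩ hU, hU1⟩
  by_contra! hlt
  have hn : n ≠ 0 := by
    rintro rfl
    simp only [pow_zero] at hlt
    linarith
  have hc : 0 ≤ 12 * sSup (USet (powCQ P n)) := by linarith
  have : (12 * sSup (USet (powCQ P n))) ^ ((n:ℝ)⁻¹) < sSup (ASet P) := by
    refine lt_of_pow_lt_pow_left₀ n (by linarith) ?_
    rwa [Real.rpow_inv_natCast_pow hc hn]
  obtain ⟨x, hx, hxl⟩ := exists_lt_of_lt_csSup ⟨_, USet_subset P (one_mem_USet P hP)⟩ this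
  have h3 := pow_lt_pow_left₀ hxl (by positivity) hn
  rw [Real.rpow_inv_natCast_pow hc hn] at h3
  linarith [lower P hP hbU hx]

/-- The no-signalling assisted zero-error capacity of a cq-graph is the semidefinite
packing number: a polynomial lower bound on `Υ` of the `n`-fold product, and the
consequent limit formula. -/
theorem upsilonCQ_pow_ge_aramCQ_pow [Nonempty I] [Nonempty B]
    (P : I → Matrix B B ℂ) (hP : ∀ i, IsProj (P i)) :
    (∃ N : ℕ, ∀ n : ℕ, N ≤ n →
      UpsilonCQ (powCQ P n) ≥ AramCQ P ^ n /
        (4 * ((n : ℝ) + 1) ^ (Fintype.card I + 2 * Fintype.card B) *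
          ((n : ℝ) + (Fintype.card B : ℝ)) ^ ((9 * (Fintype.card B : ℝ) ^ 2) / 4))) ∧
    Filter.Tendsto (fun n : ℕ => Real.log (UpsilonCQ (powCQ P n)) / (n : ℝ))
      Filter.atTop (nhds (Real.log (AramCQ P))) := by
  have hB : 1 ≤ Fintype.card B := Fintype.card_pos
  have hI : 1 ≤ Fintype.card I := Fintype.card_pos
  by_cases h0 : ∀ i, P i ≠ 0
  · have hmb := main_bounds P hP h0
    have hA := (hmb 0).1
    refine ⟨⟨1, fun n hn => ?_⟩, ?_⟩
    · obtain ⟨-, h2, h3, h4⟩ := hmb n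
      have hn' : (1:ℝ) ≤ n := by exact_mod_cast hn
      have hB' : (1:ℝ) ≤ Fintype.card B := by exact_mod_cast hB
      have d1 : (2:ℝ)^3 ≤ ((n : ℝ) + 1) ^ (Fintype.card I + 2 * Fintype.card B) := by
        calc (2:ℝ)^3 ≤ 2 ^ (Fintype.card I + 2 * Fintype.card B) :=
              pow_le_pow_right₀ (by norm_num) (by omega)
          _ ≤ _ := pow_le_pow_left₀ (by norm_num) (by linarith) _
      have d2 : (1:ℝ) ≤ ((n : ℝ) + (Fintype.card B : ℝ)) ^ ((9 * (Fintype.card B : ℝ) ^ 2) / 4) :=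
        Real.one_le_rpow (by linarith) (by positivity)
      have d3 : (12:ℝ) ≤ 4 * ((n : ℝ) + 1) ^ (Fintype.card I + 2 * Fintype.card B) *
          ((n : ℝ) + (Fintype.card B : ℝ)) ^ ((9 * (Fintype.card B : ℝ) ^ 2) / 4) := by
        nlinarith
      rw [ge_iff_le, div_le_iff₀ (by linarith)]
      nlinarith
    · have l1 : Filter.Tendsto (fun n : ℕ => Real.log (AramCQ P) - Real.log 12 / (n:ℝ))
          Filter.atTop (nhds (Real.log (AramCQ P))) := by
        have := (tendsto_const_nhds (x := Real.log (AramCQ P))).sub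
          (tendsto_const_div_atTop_nhds_zero_nat (Real.log 12))
        simpa using this
      refine tendsto_of_tendsto_of_tendsto_of_le_of_le' l1 tendsto_const_nhds ?_ ?_
      · filter_upwards [Filter.eventually_ge_atTop 1] with n hn
        obtain ⟨-, h2, h3, h4⟩ := hmb n
        have hn' : (0:ℝ) < n := by exact_mod_cast hn
        have := Real.log_le_log (by positivity) h2
        rw [Real.log_pow, Real.log_mul (by norm_num) (by linarith)] at this
        rw [le_div_iff₀ hn', sub_mul, div_mul_cancel₀ _ hn'.ne']
        linarith
      · filter_upwards [Filter.eventually_ge_atTop 1] with n hn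
        obtain ⟨-, h2, h3, h4⟩ := hmb n
        have hn' : (0:ℝ) < n := by exact_mod_cast hn
        have := Real.log_le_log (by linarith) h3
        rw [Real.log_pow] at this
        rw [div_le_iff₀ hn']
        linarith
  · push Not at h0
    obtain ⟨i, hi⟩ := h0
    have hA : AramCQ P = 0 := Real.sSup_of_not_bddAbove
      (fun h => U_unbdd P i hi (h.mono (USet_subset P)))
    have hU : ∀ n : ℕ, 1 ≤ n → UpsilonCQ (powCQ P n) = 0 := fun n hn => by
      refine Real.sSup_of_not_bddAbove (U_unbdd (powCQ P n) (fun _ => i) ?_)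
      ext b b'
      simp only [powCQ, hi, Matrix.of_apply, Matrix.zero_apply, Finset.prod_const]
      simp
      omega
    refine ⟨⟨1, fun n hn => ?_⟩, ?_⟩
    · rw [hU n hn, hA, zero_pow (by omega), zero_div]
    · refine tendsto_const_nhds.congr' ?_
      filter_upwards [Filter.eventually_ge_atTop 1] with n hn
      rw [hU n hn, hA]; simp
end
end

section
/- Let (P_i)_{i∈I} be a cq-graph on a nonempty finite input set I with output space ℂ^B, with every P_i nonzero. Then the semidefinite covering number admits the dual expression Σ({P_i}) = sup { ∑_i s_i : s_i real, s_i ≥ 0, and there exist positive semidefinite B×B matrices E_i with ∑_i E_i = 1_B and s_i • P_i ≤ P_i·E_i·P_i }. (Strong duality for the cq semidefinite covering number.) -/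
open Matrix BigOperators
open scoped ComplexOrder

noncomputable section

variable {I B : Type*} [Fintype I] [Fintype B] [DecidableEq B]

/-- Semidefinite covering number (simulation cost) of a cq-graph. -/
def SigmaCQ (P : I → Matrix B B ℂ) : ℝ :=
  sInf { x : ℝ | ∃ T : Matrix B B ℂ, x = T.trace.re ∧
    ∃ F : I → Matrix B B ℂ, ∀ i,
      loe 0 (F i) ∧ loe (F i) (P i) ∧ (F i).trace = 1 ∧ loe (F i) T }

open scoped Topology

section Aux
open scoped Matrix.Norms.L2Operator MatrixOrder

theorem aux_eventually (ε : ℝ) (hε : 0 < ε) :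
    ∀ᶠ A in 𝓝 (0 : Matrix B B ℂ), (A + Aᴴ + ε • (1 : Matrix B B ℂ)).PosSemidef := by
  have hc : Continuous fun A : Matrix B B ℂ => ‖A + Aᴴ‖ := by fun_prop
  have h0 : ∀ᶠ A in 𝓝 (0 : Matrix B B ℂ), ‖A + Aᴴ‖ < ε := by
    apply hc.continuousAt.eventually_lt_const
    simpa using hε
  filter_upwards [h0] with A hA
  have hs : IsSelfAdjoint (A + Aᴴ) := by
    rw [← Matrix.star_eq_conjTranspose]; exact IsSelfAdjoint.add_star_self A
  have h1 := hs.neg_algebraMap_norm_le_self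
  rw [Matrix.le_iff] at h1
  have h2 : ((ε - ‖A + Aᴴ‖) • (1 : Matrix B B ℂ)).PosSemidef :=
    Matrix.PosSemidef.one.smul (by linarith)
  have := h1.add h2
  have e : A + Aᴴ - -(algebraMap ℝ (Matrix B B ℂ)) ‖A + Aᴴ‖ +
      (ε - ‖A + Aᴴ‖) • (1 : Matrix B B ℂ) = A + Aᴴ + ε • (1 : Matrix B B ℂ) := by
    rw [Algebra.algebraMap_eq_smul_one, sub_smul]
    abel
  exact e ▸ this

theorem aux_sqrt {A : Matrix B B ℂ} (hA : A.PosSemidef) : ∃ C : Matrix B B ℂ, A = Cᴴ * C := by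
  have := Matrix.nonneg_iff_posSemidef.2 hA
  obtain ⟨C, hC⟩ := CStarAlgebra.nonneg_iff_eq_star_mul_self.1 this
  exact ⟨C, hC⟩
end Aux

theorem aux_trace {A C : Matrix B B ℂ} (hA : A.PosSemidef) (hC : C.PosSemidef) :
    0 ≤ (A * C).trace.re := by
  obtain ⟨D, rfl⟩ := aux_sqrt hA
  have h := (hC.mul_mul_conjTranspose_same D).trace_nonneg
  rw [Matrix.trace_mul_comm, ← Matrix.mul_assoc] at h
  exact (Complex.le_def.1 h).1

theorem aux_rep (φ : Matrix B B ℂ →ₗ[ℝ] ℝ) :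
    ∃ E : Matrix B B ℂ, E.IsHermitian ∧ ∀ H : Matrix B B ℂ, H.IsHermitian →
      φ H = (E * H).trace.re := by
  set ψ : Matrix B B ℂ →ₗ[ℂ] ℂ := Module.Dual.extendRCLike (𝕜 := ℂ) φ with hψ
  have hre : ∀ M, (ψ M).re = φ M := fun M => Module.Dual.re_extendRCLike_apply (𝕜 := ℂ) φ M
  let A : Matrix B B ℂ := fun i j => ψ (Matrix.single j i 1)
  have hA : ∀ M, ψ M = (A * M).trace := by
    intro M
    conv_lhs => rw [Matrix.matrix_eq_sum_single M]
    simp only [map_sum, Matrix.trace, Matrix.diag, Matrix.mul_apply]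
    rw [Finset.sum_comm]
    refine Finset.sum_congr rfl fun i _ => Finset.sum_congr rfl fun j _ => ?_
    have : Matrix.single j i (M j i) = M j i • Matrix.single j i (1 : ℂ) := by simp
    rw [this, map_smul, smul_eq_mul, mul_comm]
  refine ⟨(1 / 2 : ℝ) • (A + Aᴴ), ?_, ?_⟩
  · unfold Matrix.IsHermitian
    simp [Matrix.conjTranspose_add, add_comm]
  · intro H hH
    have h1 : (Aᴴ * H).trace = star ((A * H).trace) := by
      rw [← Matrix.trace_conjTranspose, Matrix.conjTranspose_mul, hH.eq, Matrix.trace_mul_comm]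
    rw [← hre, hA, Matrix.smul_mul, Matrix.add_mul, Matrix.trace_smul, Matrix.trace_add, h1]
    simp
    ring

theorem aux_support {F P : Matrix B B ℂ} (hP : IsProj P) (hF : F.PosSemidef)
    (hFP : (P - F).PosSemidef) : P * F * P = F := by
  obtain ⟨hh, hi⟩ := hP
  have hQ : (1 - P)ᴴ = 1 - P := by simp [hh.eq]
  have h1 := hFP.mul_mul_conjTranspose_same (1 - P)
  have h2 := hF.mul_mul_conjTranspose_same (1 - P)
  rw [hQ] at h1 h2
  have h3 : (1 - P) * (P - F) * (1 - P) = - ((1 - P) * F * (1 - P)) := by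
    have : (1 - P) * P = 0 := by simp [sub_mul, hi]
    rw [mul_sub (1 - P) P F, this, zero_sub, neg_mul]
  rw [h3] at h1
  have h4 : ((1 - P) * F * (1 - P)).trace = 0 := by
    apply le_antisymm
    · have := h1.trace_nonneg
      rw [Matrix.trace_neg] at this
      exact neg_nonneg.1 this
    · exact h2.trace_nonneg
  obtain ⟨C, rfl⟩ := aux_sqrt hF
  have h5 : (C * (1 - P))ᴴ * (C * (1 - P)) = (1 - P) * (Cᴴ * C) * (1 - P) := by
    rw [Matrix.conjTranspose_mul, hQ]; simp only [Matrix.mul_assoc]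
  rw [← h5, Matrix.trace_conjTranspose_mul_self_eq_zero_iff] at h4
  have h6 : C * P = C := by
    rw [mul_sub, mul_one, sub_eq_zero] at h4; exact h4.symm
  have h7 : P * Cᴴ = Cᴴ := by
    have := congrArg Matrix.conjTranspose h6
    rwa [Matrix.conjTranspose_mul, hh.eq] at this
  rw [← Matrix.mul_assoc, h7, Matrix.mul_assoc, h6]

/-- feasibility of `F` for `P`. -/
def Feas (P F : Matrix B B ℂ) : Prop :=
  F.PosSemidef ∧ (P - F).PosSemidef ∧ F.trace = 1

theorem aux_proj_psd {P : Matrix B B ℂ} (hP : IsProj P) : P.PosSemidef := by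
  have := Matrix.posSemidef_conjTranspose_mul_self P
  rwa [hP.1.eq, hP.2] at this

theorem aux_feas {P : Matrix B B ℂ} (hP : IsProj P) {y : B → ℂ} (hy : y ≠ 0)
    (hPy : P *ᵥ y = y) : ∃ n : ℝ, 0 < n ∧ star y ⬝ᵥ y = (n : ℂ) ∧
      Feas P ((n⁻¹ : ℝ) • Matrix.vecMulVec y (star y)) := by
  have h0 : 0 < star y ⬝ᵥ y := Matrix.dotProduct_star_self_pos_iff.2 hy
  obtain ⟨hre, him⟩ := Complex.lt_def.1 h0
  have hn : star y ⬝ᵥ y = ((star y ⬝ᵥ y).re : ℂ) := by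
    apply Complex.ext
    · simp
    · simpa using him.symm
  set n := (star y ⬝ᵥ y).re with hn'
  have hre : 0 < n := hre
  set V := Matrix.vecMulVec y (star y) with hV
  have hVp : V.PosSemidef := Matrix.posSemidef_vecMulVec_self_star y
  have hPV : P * V = V := by rw [hV, Matrix.mul_vecMulVec, hPy]
  have hVP : V * P = V := by
    have := congrArg Matrix.conjTranspose hPV
    rwa [Matrix.conjTranspose_mul, hP.1.eq, hVp.1.eq] at this
  have hVV : V * V = n • V := by
    rw [hV, Matrix.vecMulVec_mul_vecMulVec, hn]
    ext i j
    simp [Matrix.vecMulVec_apply]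
    try ring
  refine ⟨n, hre, hn, hVp.smul (inv_nonneg.2 hre.le), ?_, ?_⟩
  · apply aux_proj_psd
    refine ⟨hP.1.sub (hVp.smul (inv_nonneg.2 hre.le)).1, ?_⟩
    rw [sub_mul, mul_sub, mul_sub, Matrix.mul_smul, Matrix.smul_mul, Matrix.smul_mul,
      Matrix.mul_smul, hPV, hVP, hVV, hP.2, smul_smul n⁻¹ n, inv_mul_cancel₀ hre.ne']
    simp
  · rw [Matrix.trace_smul, hV, Matrix.trace_vecMulVec, dotProduct_comm, hn]
    simp [hre.ne']

theorem aux_feas_exists {P : Matrix B B ℂ} (hP : IsProj P) (hne : P ≠ 0) : ∃ F, Feas P F := by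
  have : ∃ x, P *ᵥ x ≠ 0 := by
    by_contra! h
    apply hne
    apply Matrix.ext_of_mulVec_single
    intro i
    rw [h, Matrix.zero_mulVec]
  obtain ⟨x, hx⟩ := this
  obtain ⟨n, _, _, h⟩ := aux_feas hP hx (by rw [Matrix.mulVec_mulVec, hP.2])
  exact ⟨_, h⟩

theorem aux_one_sub {P F : Matrix B B ℂ} (hP : IsProj P) (h : Feas P F) :
    (1 - F).PosSemidef := by
  have h1 : IsProj (1 - P) := by
    refine ⟨Matrix.isHermitian_one.sub hP.1, ?_⟩
    simp [sub_mul, mul_sub, hP.2]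
  have := (aux_proj_psd h1).add h.2.1
  simpa using this

theorem aux_lin {a b d : ℝ} (h : ∀ k : ℝ, 0 ≤ k → a - k * b < d) : 0 ≤ b := by
  by_contra! hb
  have h1 := h ((|d| + |a|) / (-b)) (div_nonneg (by positivity) (by linarith))
  have h2 : (|d| + |a|) / (-b) * b = -(|d| + |a|) := by
    rw [div_neg, neg_mul, div_mul_cancel₀ _ hb.ne]
  rw [h2] at h1
  linarith [le_abs_self d, neg_abs_le a]

theorem aux_dual_loe {P E : Matrix B B ℂ} (hP : IsProj P) (hE : E.PosSemidef) {s : ℝ}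
    (h : ∀ F, Feas P F → s ≤ (E * F).trace.re) : loe (s • P) (P * E * P) := by
  have hH1 : (P * E * P).IsHermitian := by
    have := Matrix.isHermitian_conjTranspose_mul_mul P hE.1
    rwa [hP.1.eq] at this
  have hH2 : (s • P).IsHermitian := by
    unfold Matrix.IsHermitian
    rw [Matrix.conjTranspose_smul, hP.1.eq]; simp
  refine Matrix.PosSemidef.of_dotProduct_mulVec_nonneg (hH1.sub hH2) fun x => ?_
  set y := P *ᵥ x with hy
  have hsy : star x ᵥ* P = star y := by
    rw [hy, Matrix.star_mulVec, hP.1.eq]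
  have hPy : P *ᵥ y = y := by rw [hy, Matrix.mulVec_mulVec, hP.2]
  have e1 : star x ⬝ᵥ ((P * E * P - s • P) *ᵥ x) = star y ⬝ᵥ (E *ᵥ y) - s • (star y ⬝ᵥ y) := by
    rw [Matrix.sub_mulVec, dotProduct_sub, Matrix.smul_mulVec, dotProduct_smul]
    congr 1
    · rw [← Matrix.mulVec_mulVec, ← Matrix.mulVec_mulVec, ← hy, Matrix.dotProduct_mulVec, hsy]
    · congr 1
      rw [← hy]
      conv_lhs => rw [← hPy, Matrix.dotProduct_mulVec, hsy]
  rw [e1]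
  by_cases hy0 : y = 0
  · simp [hy0]
  obtain ⟨n, hn, hyn, hF⟩ := aux_feas hP hy0 hPy
  have h1 := h _ hF
  have h2 : (E * Matrix.vecMulVec y (star y)).trace = star y ⬝ᵥ (E *ᵥ y) := by
    rw [Matrix.mul_vecMulVec, Matrix.trace_vecMulVec, dotProduct_comm]
  rw [Matrix.mul_smul, Matrix.trace_smul, h2] at h1
  have h3 := hE.dotProduct_mulVec_nonneg y
  obtain ⟨h3r, h3i⟩ := Complex.le_def.1 h3
  rw [hyn]
  rw [Complex.le_def]
  have h4 : s ≤ n⁻¹ * (star y ⬝ᵥ (E *ᵥ y)).re := by simpa using h1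
  have h5 : s * n ≤ (star y ⬝ᵥ (E *ᵥ y)).re := by
    rw [inv_mul_eq_div, le_div_iff₀ hn] at h4; exact h4
  constructor
  · simpa using h5
  · simpa using h3i

theorem aux_weak {P : I → Matrix B B ℂ} (hP : ∀ i, IsProj (P i)) {F : I → Matrix B B ℂ}
    {T : Matrix B B ℂ} (hF : ∀ i, Feas (P i) (F i)) (hT : ∀ i, (T - F i).PosSemidef)
    {s : I → ℝ} {E : I → Matrix B B ℂ} (hE : ∀ i, (E i).PosSemidef)
    (hE1 : (∑ i, E i) = 1) (hs : ∀ i, loe (s i • P i) (P i * E i * P i)) :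
    ∑ i, s i ≤ T.trace.re := by
  have h1 : ∀ i, s i ≤ (E i * T).trace.re := by
    intro i
    have ha := aux_trace (hs i) (hF i).1
    have hb := aux_trace (hE i) (hT i)
    have hsup := aux_support (hP i) (hF i).1 (hF i).2.1
    have hPF : P i * F i = F i := by
      conv_rhs => rw [← hsup]
      conv_lhs => rw [← hsup, ← Matrix.mul_assoc, ← Matrix.mul_assoc, (hP i).2]
    have e1 : (P i * E i * P i * F i).trace = (E i * F i).trace := by
      rw [Matrix.mul_assoc, Matrix.mul_assoc, Matrix.trace_mul_comm, Matrix.mul_assoc, hsup]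
    rw [sub_mul, Matrix.trace_sub, e1, Matrix.smul_mul, hPF, Matrix.trace_smul, (hF i).2.2] at ha
    rw [mul_sub, Matrix.trace_sub] at hb
    simp at ha hb
    linarith
  calc ∑ i, s i ≤ ∑ i, (E i * T).trace.re := Finset.sum_le_sum fun i _ => h1 i
    _ = T.trace.re := by
      rw [← Complex.re_sum, ← Matrix.trace_sum, ← Finset.sum_mul, hE1, one_mul]

/-- the separating set. -/
def KSet (P : I → Matrix B B ℂ) : Set ((I → Matrix B B ℂ) × ℝ) :=
  { x | ∃ (F : I → Matrix B B ℂ) (T : Matrix B B ℂ) (ε : ℝ), 0 < ε ∧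
    (∀ i, Feas (P i) (F i)) ∧ T.trace.re < x.2 ∧
    ∀ i, ((T - F i - x.1 i) + (T - F i - x.1 i)ᴴ - ε • (1 : Matrix B B ℂ)).PosSemidef }

theorem KSet_open (P : I → Matrix B B ℂ) : IsOpen (KSet P) := by
  rw [isOpen_iff_mem_nhds]
  rintro ⟨M, r⟩ ⟨F, T, ε, hε, hF, hr, hM⟩
  have h1 : ∀ᶠ x in 𝓝 (M, r), T.trace.re < x.2 :=
    continuousAt_snd.eventually_const_lt hr
  have h2 : ∀ᶠ x in 𝓝 (M, r), ∀ i, ((M i - x.1 i) + (M i - x.1 i)ᴴ +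
      (ε / 2) • (1 : Matrix B B ℂ)).PosSemidef := by
    rw [Filter.eventually_all]
    intro i
    have hc : Continuous fun x : (I → Matrix B B ℂ) × ℝ => M i - x.1 i := by fun_prop
    have ht := hc.tendsto (M, r)
    simp only [sub_self] at ht
    exact ht.eventually (aux_eventually (ε / 2) (by linarith))
  filter_upwards [h1, h2] with x hx1 hx2
  refine ⟨F, T, ε / 2, by linarith, hF, hx1, fun i => ?_⟩
  have := (hM i).add (hx2 i)
  have e : (T - F i - x.1 i) + (T - F i - x.1 i)ᴴ - (ε / 2) • (1 : Matrix B B ℂ) =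
      (T - F i - M i) + (T - F i - M i)ᴴ - ε • (1 : Matrix B B ℂ) + ((M i - x.1 i) +
        (M i - x.1 i)ᴴ + (ε / 2) • (1 : Matrix B B ℂ)) := by
    simp only [Matrix.conjTranspose_sub]
    module
  rw [e]; exact this

theorem Feas_convex {P F G : Matrix B B ℂ} (hF : Feas P F) (hG : Feas P G) {a b : ℝ}
    (ha : 0 ≤ a) (hb : 0 ≤ b) (hab : a + b = 1) : Feas P (a • F + b • G) := by
  refine ⟨(hF.1.smul ha).add (hG.1.smul hb), ?_, ?_⟩
  · have := (hF.2.1.smul ha).add (hG.2.1.smul hb)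
    have e : P - (a • F + b • G) = a • (P - F) + b • (P - G) := by
      have : P = (a + b) • P := by rw [hab, one_smul]
      conv_lhs => rw [this]
      module
    rw [e]; exact this
  · rw [Matrix.trace_add, Matrix.trace_smul, Matrix.trace_smul, hF.2.2, hG.2.2]
    rw [← add_smul, hab, one_smul]

theorem KSet_convex (P : I → Matrix B B ℂ) : Convex ℝ (KSet P) := by
  rintro ⟨M, r⟩ ⟨F, T, ε, hε, hF, hr, hM⟩ ⟨M', r'⟩ ⟨F', T', ε', hε', hF', hr', hM'⟩ a b ha hb hab
  refine ⟨fun i => a • F i + b • F' i, a • T + b • T', a * ε + b * ε', ?_,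
    fun i => Feas_convex (hF i) (hF' i) ha hb hab, ?_, fun i => ?_⟩
  · rcases ha.eq_or_lt with h | h
    · subst h
      have : b = 1 := by linarith
      subst this; simpa using hε'
    · have := mul_pos h hε
      have := mul_nonneg hb hε'.le
      linarith
  · simp only [Matrix.trace_add, Matrix.trace_smul, Prod.snd_add, Prod.smul_snd, Complex.add_re,
      Complex.real_smul, Complex.re_ofReal_mul, smul_eq_mul]
    simp only at hr hr'
    rcases ha.eq_or_lt with h | h
    · subst h
      have : b = 1 := by linarith
      subst this; simpa using hr'
    · have := mul_lt_mul_of_pos_left hr h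
      have := mul_le_mul_of_nonneg_left hr'.le hb
      linarith
  · have := ((hM i).smul ha).add ((hM' i).smul hb)
    convert this using 1
    simp only [Matrix.conjTranspose_sub, Matrix.conjTranspose_add, Matrix.conjTranspose_smul,
      Prod.fst_add, Prod.smul_fst, Pi.add_apply, Pi.smul_apply, star_trivial]
    module

theorem aux_strong [Nonempty I] (P : I → Matrix B B ℂ) (hP : ∀ i, IsProj (P i))
    (hne : ∀ i, P i ≠ 0) (c : ℝ)
    (hc : ∀ (F : I → Matrix B B ℂ) (T : Matrix B B ℂ), (∀ i, Feas (P i) (F i)) →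
      (∀ i, (T - F i).PosSemidef) → c ≤ T.trace.re) :
    ∃ E : I → Matrix B B ℂ, (∀ i, (E i).PosSemidef) ∧ (∑ i, E i) = 1 ∧
      ∀ F : I → Matrix B B ℂ, (∀ i, Feas (P i) (F i)) → c ≤ ∑ i, (E i * F i).trace.re := by
  classical
  have hnot : ((0 : I → Matrix B B ℂ), c) ∉ KSet P := by
    rintro ⟨F, T, ε, hε, hF, hr, hM⟩
    have h := hc F ((1 / 2 : ℝ) • (T + Tᴴ)) hF fun i => by
      have h1 := ((hM i).add (Matrix.PosSemidef.one.smul hε.le)).smul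
        (show (0 : ℝ) ≤ 1 / 2 by norm_num)
      convert h1 using 1
      simp only [Pi.zero_apply, sub_zero, Matrix.conjTranspose_sub, (hF i).1.1.eq]
      module
    rw [Matrix.trace_smul, Matrix.trace_add, Matrix.trace_conjTranspose] at h
    simp at h hr
    linarith
  obtain ⟨f, hf⟩ := geometric_hahn_banach_open_point (KSet_convex P) (KSet_open P) hnot
  let L : (I → Matrix B B ℂ) →ₗ[ℝ] ℝ := f.toLinearMap ∘ₗ LinearMap.inl ℝ _ _
  set β : ℝ := f (0, 1) with hβ
  have hfL : ∀ M r, f (M, r) = L M + r * β := by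
    intro M r
    have : (M, r) = (M, (0 : ℝ)) + r • ((0 : I → Matrix B B ℂ), (1 : ℝ)) := by simp
    rw [this, map_add, map_smul]; rfl
  have key : ∀ (T : Matrix B B ℂ) (F D : I → Matrix B B ℂ) (ε δ : ℝ), T.IsHermitian →
      (∀ i, Feas (P i) (F i)) → 0 < ε → 0 < δ → (∀ i, (D i - ε • (1 : Matrix B B ℂ)).PosSemidef) →
      L (fun _ => T) - L F - L D + (T.trace.re + δ) * β < c * β := by
    intro T F D ε δ hT hF hε hδ hD
    have hmem : ((fun _ => T) - F - D, T.trace.re + δ) ∈ KSet P := by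
      refine ⟨F, T, 2 * ε, by linarith, hF, by simp [hδ], fun i => ?_⟩
      have hDh : (D i).IsHermitian := by
        have := (hD i).add (Matrix.PosSemidef.one.smul hε.le)
        rw [sub_add_cancel] at this
        exact this.1
      have h1 := (hD i).smul (show (0 : ℝ) ≤ 2 by norm_num)
      convert h1 using 1
      simp only [Pi.sub_apply, Matrix.conjTranspose_sub, (hF i).1.1.eq, hT.eq, hDh.eq]
      module
    have := hf _ hmem
    rw [hfL, hfL, map_zero, map_sub, map_sub] at this
    linarith
  choose F0 hF0 using fun i => aux_feas_exists (hP i) (hne i)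
  have hβneg : β < 0 := by
    have htr : 0 ≤ ((2 : ℝ) • (1 : Matrix B B ℂ)).trace.re :=
      (Complex.le_def.1 (Matrix.PosSemidef.one.smul (show (0 : ℝ) ≤ 2 by norm_num)).trace_nonneg).1
    have h := key ((2 : ℝ) • 1) F0 ((fun _ => (2 : ℝ) • (1 : Matrix B B ℂ)) - F0) 1 (|c| + 1)
      (Matrix.PosSemidef.one.smul (show (0 : ℝ) ≤ 2 by norm_num)).1 hF0 one_pos (by positivity)
      (fun i => by
        have := aux_one_sub (hP i) (hF0 i)
        convert this using 1
        simp only [Pi.sub_apply]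
        module)
    rw [map_sub] at h
    by_contra! hb
    have hlt : c ≤ ((2 : ℝ) • (1 : Matrix B B ℂ)).trace.re + (|c| + 1) := by
      linarith [le_abs_self c]
    have := mul_le_mul_of_nonneg_right hlt hb
    linarith
  have hLpos : ∀ D : I → Matrix B B ℂ, (∀ i, (D i).PosSemidef) → 0 ≤ L D := by
    intro D hD
    apply aux_lin (a := - L F0 - L (fun _ => 1) + β) (d := c * β)
    intro k hk
    have h := key 0 F0 (k • D + fun _ => 1) 1 1 Matrix.isHermitian_zero hF0 one_pos one_pos
      (fun i => by simpa using (hD i).smul hk)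
    have h0 : L (fun _ => (0 : Matrix B B ℂ)) = 0 := L.map_zero
    rw [h0, map_add, map_smul] at h
    simp at h
    linarith
  have hLT : ∀ T : Matrix B B ℂ, T.IsHermitian → 0 ≤ - (L (fun _ => T) + T.trace.re * β) := by
    intro T hT
    apply aux_lin (a := - L F0 - L (fun _ => 1) + β) (d := c * β)
    intro k hk
    have h := key (k • T) F0 (fun _ => 1) 1 1
      (by unfold Matrix.IsHermitian; rw [Matrix.conjTranspose_smul, hT.eq]; simp) hF0
      one_pos one_pos (fun i => by simpa using Matrix.PosSemidef.zero)
    have h0 : L (fun _ => k • T) = k * L (fun _ => T) := L.map_smul k (fun _ => T)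
    rw [h0, Matrix.trace_smul] at h
    simp at h
    linarith
  have hLT' : ∀ T : Matrix B B ℂ, T.IsHermitian → L (fun _ => T) = - (T.trace.re * β) := by
    intro T hT
    have h1 := hLT T hT
    have h2 := hLT (-T) hT.neg
    have h0 : L (fun _ => -T) = - L (fun _ => T) := L.map_neg (fun _ => T)
    rw [h0, Matrix.trace_neg, Complex.neg_re] at h2
    linarith
  have hLF : ∀ F : I → Matrix B B ℂ, (∀ i, Feas (P i) (F i)) → - (c * β) ≤ L F := by
    intro F hF
    by_contra! hlt
    have hL1 : 0 ≤ L (fun _ => 1) := hLpos _ fun _ => Matrix.PosSemidef.one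
    have hpos : 0 < L (fun _ => 1) + 1 - β := by linarith
    set ε := (-(c * β) - L F) / (L (fun _ => 1) + 1 - β) with hε
    have hε0 : 0 < ε := div_pos (by linarith) hpos
    have hεm : ε * (L (fun _ => 1) + 1 - β) = -(c * β) - L F := div_mul_cancel₀ _ hpos.ne'
    have h := key 0 F (ε • fun _ => 1) ε ε Matrix.isHermitian_zero hF hε0 hε0
      (fun i => by simpa using Matrix.PosSemidef.zero)
    have h0 : L (fun _ => (0 : Matrix B B ℂ)) = 0 := L.map_zero
    rw [h0, map_smul] at h
    simp at h
    nlinarith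
  choose E hEh hE using fun i => aux_rep ((-β)⁻¹ • (L ∘ₗ LinearMap.single ℝ (fun _ => Matrix B B ℂ) i))
  have hsum : ∀ M : I → Matrix B B ℂ, (∀ i, (M i).IsHermitian) →
      ∑ i, (E i * M i).trace.re = (-β)⁻¹ * L M := by
    intro M hM
    have : L M = ∑ i, L (Pi.single i (M i)) := by
      rw [← map_sum, Finset.univ_sum_single]
    rw [this, Finset.mul_sum]
    refine Finset.sum_congr rfl fun i _ => ?_
    rw [← hE i _ (hM i)]
    simp
  have hβi : 0 < (-β)⁻¹ := inv_pos.2 (by linarith)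
  refine ⟨E, fun i => ?_, ?_, fun F hF => ?_⟩
  · refine Matrix.PosSemidef.of_dotProduct_mulVec_nonneg (hEh i) fun x => ?_
    have hVp : (Matrix.vecMulVec x (star x)).PosSemidef := Matrix.posSemidef_vecMulVec_self_star x
    have h2 : (E i * Matrix.vecMulVec x (star x)).trace = star x ⬝ᵥ (E i *ᵥ x) := by
      rw [Matrix.mul_vecMulVec, Matrix.trace_vecMulVec, dotProduct_comm]
    have h1 := hE i _ hVp.1
    rw [h2] at h1
    have h3 : 0 ≤ L (Pi.single i (Matrix.vecMulVec x (star x))) := by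
      apply hLpos
      intro j
      by_cases hj : j = i
      · subst hj; simpa using hVp
      · simpa [hj] using Matrix.PosSemidef.zero
    rw [Complex.le_def]
    constructor
    · rw [← h1]
      exact mul_nonneg hβi.le h3
    · exact ((hEh i).im_star_dotProduct_mulVec_self x).symm
  · have hG : (∑ i, E i - 1).IsHermitian := by
      refine Matrix.IsHermitian.sub ?_ Matrix.isHermitian_one
      unfold Matrix.IsHermitian
      rw [Matrix.conjTranspose_sum]
      exact Finset.sum_congr rfl fun i _ => (hEh i).eq
    set G := ∑ i, E i - 1 with hGd
    have h1 : ((∑ i, E i) * G).trace.re = G.trace.re := by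
      have := hsum (fun _ => G) fun _ => hG
      rw [hLT' G hG, ← Complex.re_sum, ← Matrix.trace_sum, ← Finset.sum_mul] at this
      rw [this]
      have hb0 := hβneg.ne
      field_simp
    have h2 : (Gᴴ * G).trace = 0 := by
      apply Complex.ext
      · rw [hG.eq]
        conv_lhs => rw [hGd, sub_mul, one_mul, Matrix.trace_sub, Complex.sub_re]
        rw [← hGd, h1]; simp
      · exact (Complex.le_def.1 (Matrix.posSemidef_conjTranspose_mul_self G).trace_nonneg).2.symm
    rw [Matrix.trace_conjTranspose_mul_self_eq_zero_iff] at h2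
    exact sub_eq_zero.1 h2
  · rw [hsum F fun i => (hF i).1.1]
    have h := mul_le_mul_of_nonneg_left (hLF F hF) hβi.le
    have e : (-β)⁻¹ * -(c * β) = c := by
      have := hβneg.ne
      field_simp
    rwa [e] at h

/-- Strong duality for the cq semidefinite covering number. -/
theorem sigmaCQ_strong_duality [Nonempty I] [Nonempty B]
    (P : I → Matrix B B ℂ) (hP : ∀ i, IsProj (P i)) (hne : ∀ i, P i ≠ 0) :
    SigmaCQ P = sSup { x : ℝ | ∃ s : I → ℝ, (∀ i, 0 ≤ s i) ∧ x = ∑ i, s i ∧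
      ∃ E : I → Matrix B B ℂ, (∀ i, (E i).PosSemidef) ∧ (∑ i, E i) = 1 ∧
        ∀ i, loe (s i • P i) (P i * E i * P i) } := by
  have hconv : ∀ (F : I → Matrix B B ℂ) (T : Matrix B B ℂ), (∀ i,
      loe 0 (F i) ∧ loe (F i) (P i) ∧ (F i).trace = 1 ∧ loe (F i) T) ↔
      (∀ i, Feas (P i) (F i)) ∧ ∀ i, (T - F i).PosSemidef := by
    intro F T
    simp only [loe, Feas, sub_zero, ← forall_and]
    exact forall_congr' fun i => by tauto
  unfold SigmaCQ
  simp only [hconv]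
  set A := { x : ℝ | ∃ T : Matrix B B ℂ, x = T.trace.re ∧
    ∃ F : I → Matrix B B ℂ, (∀ i, Feas (P i) (F i)) ∧ ∀ i, (T - F i).PosSemidef } with hA
  set S := { x : ℝ | ∃ s : I → ℝ, (∀ i, 0 ≤ s i) ∧ x = ∑ i, s i ∧
      ∃ E : I → Matrix B B ℂ, (∀ i, (E i).PosSemidef) ∧ (∑ i, E i) = 1 ∧
        ∀ i, loe (s i • P i) (P i * E i * P i) } with hS
  choose F0 hF0 using fun i => aux_feas_exists (hP i) (hne i)
  have hweak : ∀ x ∈ S, ∀ y ∈ A, x ≤ y := by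
    rintro x ⟨s, hs0, rfl, E, hE, hE1, hs⟩ y ⟨T, rfl, F, hF, hT⟩
    exact aux_weak hP hF hT hE hE1 hs
  have hAne : A.Nonempty := ⟨_, 1, rfl, F0, hF0, fun i => aux_one_sub (hP i) (hF0 i)⟩
  have hAbdd : BddBelow A := by
    refine ⟨0, ?_⟩
    rintro y ⟨T, rfl, F, hF, hT⟩
    obtain ⟨i⟩ := ‹Nonempty I›
    have := (hT i).add (hF i).1
    rw [sub_add_cancel] at this
    exact (Complex.le_def.1 this.trace_nonneg).1
  obtain ⟨E, hE, hE1, hEF⟩ := aux_strong P hP hne (sInf A)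
    (fun F T hF hT => csInf_le hAbdd ⟨T, rfl, F, hF, hT⟩)
  let V : I → Set ℝ := fun i => {x | ∃ F, Feas (P i) F ∧ x = (E i * F).trace.re}
  have hV0 : ∀ i, ∀ x ∈ V i, 0 ≤ x := by
    rintro i x ⟨F, hF, rfl⟩
    exact aux_trace (hE i) hF.1
  have hVne : ∀ i, (V i).Nonempty := fun i => ⟨_, F0 i, hF0 i, rfl⟩
  have hmem : ∑ i, sInf (V i) ∈ S := by
    refine ⟨fun i => sInf (V i), fun i => le_csInf (hVne i) (hV0 i), rfl, E, hE, hE1, fun i => ?_⟩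
    exact aux_dual_loe (hP i) (hE i) fun F hF => csInf_le ⟨0, hV0 i⟩ ⟨F, hF, rfl⟩
  have hle : sInf A ≤ ∑ i, sInf (V i) := by
    apply le_of_forall_pos_le_add
    intro ε hε
    have hcard : (0 : ℝ) < Fintype.card I := by exact_mod_cast Fintype.card_pos
    have : ∀ i, ∃ F, Feas (P i) F ∧ (E i * F).trace.re < sInf (V i) + ε / Fintype.card I := by
      intro i
      obtain ⟨x, ⟨F, hF, rfl⟩, hx⟩ := exists_lt_of_csInf_lt (hVne i)
        (show sInf (V i) < sInf (V i) + ε / Fintype.card I by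
          have := div_pos hε hcard
          linarith)
      exact ⟨F, hF, hx⟩
    choose F hF hFl using this
    calc sInf A ≤ ∑ i, (E i * F i).trace.re := hEF F hF
      _ ≤ ∑ i, (sInf (V i) + ε / Fintype.card I) := Finset.sum_le_sum fun i _ => (hFl i).le
      _ = ∑ i, sInf (V i) + ε := by
        rw [Finset.sum_add_distrib]
        simp only [Finset.sum_const, Finset.card_univ, nsmul_eq_mul]
        rw [mul_div_cancel₀ _ hcard.ne']
  apply le_antisymm
  · obtain ⟨y, hy⟩ := hAne
    exact hle.trans (le_csSup ⟨y, fun x hx => hweak x hx y hy⟩ hmem)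
  · exact csSup_le ⟨_, hmem⟩ fun x hx => le_csInf hAne fun y hy => hweak x hx y hy
end
end

section
/- Let (P_i)_{i∈I} be a cq-graph with output space ℂ^{B₁} and (Q_j)_{j∈J} a cq-graph with output space ℂ^{B₂}, both on nonempty finite input sets and with all P_i and Q_j nonzero. Then the semidefinite covering number is multiplicative under tensor products: Σ({P_i ⊗ Q_j}_{(i,j)∈I×J}) = Σ({P_i}) · Σ({Q_j}), where P_i ⊗ Q_j denotes the Kronecker product projection on ℂ^(B₁×B₂). -/
open Matrix BigOperators
open scoped ComplexOrder

noncomputable section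

variable {I B : Type*} [Fintype I] [Fintype B] [DecidableEq B]

namespace CQ
set_option linter.unusedSectionVars false
open Kronecker

section basic
variable {n m : Type*} [Fintype n] [DecidableEq n] [Fintype m] [DecidableEq m]

/-- densities dominated by `P` -/
def Dn (P F : Matrix n n ℂ) : Prop := F.PosSemidef ∧ (P - F).PosSemidef ∧ F.trace = 1

open scoped MatrixOrder in
lemma psd_sq {A : Matrix n n ℂ} (hA : A.PosSemidef) : ∃ G : Matrix n n ℂ, A = Gᴴ * G := by
  obtain ⟨B, hB⟩ := CStarAlgebra.nonneg_iff_eq_star_mul_self.mp hA.nonneg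
  exact ⟨B, hB⟩

lemma tr_nonneg {A B : Matrix n n ℂ} (hA : A.PosSemidef) (hB : B.PosSemidef) :
    0 ≤ ((A * B).trace).re := by
  obtain ⟨G, rfl⟩ := psd_sq hA
  rw [Matrix.mul_assoc, Matrix.trace_mul_comm]
  exact (Complex.le_def.1 (hB.mul_mul_conjTranspose_same G).trace_nonneg).1

lemma proj_psd {P : Matrix n n ℂ} (hP : IsProj P) : P.PosSemidef := by
  have := posSemidef_conjTranspose_mul_self P
  rwa [hP.1, hP.2] at this

lemma psd_rsmul {A : Matrix n n ℂ} (hA : A.PosSemidef) {c : ℝ} (hc : 0 ≤ c) :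
    (c • A).PosSemidef := by
  have := hA.smul (α := ℝ) hc
  exact this

lemma pure_dn {P : Matrix n n ℂ} (hP : IsProj P) (x : n → ℂ) (hx : P *ᵥ x = x)
    (h1 : star x ⬝ᵥ x = 1) : Dn P (vecMulVec x (star x)) := by
  have hF : (vecMulVec x (star x)).IsHermitian := (posSemidef_vecMulVec_self_star x).1
  have hFF : vecMulVec x (star x) * vecMulVec x (star x) = vecMulVec x (star x) := by
    rw [vecMulVec_mul_vecMulVec, h1]; simp
  have hPF : P * vecMulVec x (star x) = vecMulVec x (star x) := by
    rw [mul_vecMulVec, hx]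
  have hFP : vecMulVec x (star x) * P = vecMulVec x (star x) := by
    have := congrArg conjTranspose hPF
    rwa [conjTranspose_mul, hF.eq, hP.1.eq] at this
  refine ⟨posSemidef_vecMulVec_self_star x, proj_psd ⟨hP.1.sub hF, ?_⟩, ?_⟩
  · rw [sub_mul, mul_sub, mul_sub, hP.2, hPF, hFP, hFF]; simp
  · rw [trace_vecMulVec, dotProduct_comm, h1]

lemma normalize (y : n → ℂ) (hy : y ≠ 0) : ∃ c : ℝ, 0 < c ∧ star y ⬝ᵥ y = (c : ℂ) ^ 2 := by
  have h : 0 < star y ⬝ᵥ y := dotProduct_star_self_pos_iff.2 hy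
  obtain ⟨h1, h2⟩ := Complex.lt_def.1 h
  refine ⟨Real.sqrt (star y ⬝ᵥ y).re, Real.sqrt_pos.2 h1, ?_⟩
  rw [← Complex.ofReal_pow, Real.sq_sqrt h1.le]
  apply Complex.ext <;> simp
  simpa using h2.symm

lemma pure_dn' {P : Matrix n n ℂ} (hP : IsProj P) (y : n → ℂ) (hy : P *ᵥ y = y) (hne : y ≠ 0) :
    ∃ c : ℝ, 0 < c ∧ star y ⬝ᵥ y = (c : ℂ) ^ 2 ∧
      ∃ F, Dn P F ∧ vecMulVec y (star y) = ((c : ℂ) ^ 2) • F := by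
  obtain ⟨c, hc, h⟩ := normalize y hne
  have hc' : (c : ℂ) ≠ 0 := by exact_mod_cast hc.ne'
  refine ⟨c, hc, h, _, pure_dn hP ((c : ℂ)⁻¹ • y) (by rw [mulVec_smul, hy]) ?_, ?_⟩
  · simp only [star_smul, smul_dotProduct, dotProduct_smul, h]
    simp; field_simp
  · simp only [star_smul, smul_vecMulVec, vecMulVec_smul, smul_smul]
    simp; field_simp; simp

lemma dn_nonempty {P : Matrix n n ℂ} (hP : IsProj P) (hne : P ≠ 0) : ∃ F, Dn P F := by
  have : ∃ x, P *ᵥ x ≠ 0 := by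
    by_contra! h
    apply hne
    ext i j
    simpa using congrFun (h (Pi.single j 1)) i
  obtain ⟨x, hx⟩ := this
  obtain ⟨c, _, _, F, hF, _⟩ := pure_dn' hP (P *ᵥ x) (by rw [mulVec_mulVec, hP.2]) hx
  exact ⟨F, hF⟩

lemma support {P F : Matrix n n ℂ} (hP : IsProj P) (hF : Dn P F) : P * F * P = F := by
  have hQ : (1 - P)ᴴ = 1 - P := by rw [conjTranspose_sub, hP.1.eq]; simp
  have h1 := hF.2.1.conjTranspose_mul_mul_same (1 - P)
  obtain ⟨G, hG⟩ := psd_sq hF.1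
  have e : P * (1 - P) = 0 := by rw [mul_sub, hP.2]; simp
  have h2 : (1 - P)ᴴ * (P - F) * (1 - P) = -((G * (1 - P))ᴴ * (G * (1 - P))) := by
    rw [mul_assoc, sub_mul, e, hG, conjTranspose_mul]
    simp [mul_assoc]
  rw [h2] at h1
  have h3 := posSemidef_conjTranspose_mul_self (G * (1 - P))
  have h4 : ((G * (1 - P))ᴴ * (G * (1 - P))).trace = 0 := by
    apply le_antisymm
    · have := h1.trace_nonneg
      simpa using this
    · exact h3.trace_nonneg
  have h5 : G * (1 - P) = 0 := trace_conjTranspose_mul_self_eq_zero_iff.1 h4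
  have h6 : F * P = F := by
    have : F * (1 - P) = 0 := by rw [hG, mul_assoc, h5]; simp
    rw [mul_sub, mul_one] at this
    exact (sub_eq_zero.1 this).symm
  have h7 : P * F = F := by
    have := congrArg conjTranspose h6
    rwa [conjTranspose_mul, hF.1.1.eq, hP.1.eq] at this
  rw [h7, h6]

lemma proj_kron {P : Matrix n n ℂ} {Q : Matrix m m ℂ} (hP : IsProj P) (hQ : IsProj Q) :
    IsProj (P ⊗ₖ Q) := by
  refine ⟨?_, ?_⟩
  · rw [IsHermitian, conjTranspose_kronecker, hP.1.eq, hQ.1.eq]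
  · rw [← mul_kronecker_mul, hP.2, hQ.2]

lemma kron_sub_psd {A A' : Matrix n n ℂ} {B B' : Matrix m m ℂ} (hA : A.PosSemidef)
    (hB' : B'.PosSemidef) (h1 : (A' - A).PosSemidef) (h2 : (B' - B).PosSemidef) :
    (A' ⊗ₖ B' - A ⊗ₖ B).PosSemidef := by
  have : A' ⊗ₖ B' - A ⊗ₖ B = (A' - A) ⊗ₖ B' + A ⊗ₖ (B' - B) := by
    rw [sub_eq_add_neg A' A, sub_eq_add_neg B' B, add_kronecker, kronecker_add]
    ext i j; simp [kroneckerMap_apply]; ring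
  rw [this]
  exact (h1.kronecker hB').add (hA.kronecker h2)

lemma dn_kron {P F : Matrix n n ℂ} {Q G : Matrix m m ℂ} (hQ : IsProj Q)
    (hF : Dn P F) (hG : Dn Q G) : Dn (P ⊗ₖ Q) (F ⊗ₖ G) := by
  refine ⟨hF.1.kronecker hG.1, kron_sub_psd hF.1 (proj_psd hQ) hF.2.1 hG.2.1, ?_⟩
  rw [trace_kronecker, hF.2.2, hG.2.2, mul_one]

/-- compressed bound -/
lemma compress {P R : Matrix n n ℂ} (hP : IsProj P) (hR : R.PosSemidef) {s : ℝ}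
    (h : ∀ F, Dn P F → s ≤ ((R * F).trace).re) : (P * R * P - s • P).PosSemidef := by
  have hPRP : (P * R * P).PosSemidef := by
    have := hR.conjTranspose_mul_mul_same P
    rwa [hP.1.eq] at this
  have hH : (P * R * P - s • P).IsHermitian := by
    apply hPRP.1.sub
    rw [IsHermitian, conjTranspose_smul, hP.1.eq]; simp
  refine .of_dotProduct_mulVec_nonneg hH fun x => ?_
  have key : star x ⬝ᵥ (P * R * P - s • P) *ᵥ x
      = (R * vecMulVec (P *ᵥ x) (star (P *ᵥ x))).trace - s * (star (P *ᵥ x) ⬝ᵥ (P *ᵥ x)) := by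
    rw [mul_vecMulVec, trace_vecMulVec, star_mulVec, hP.1.eq, dotProduct_comm (R *ᵥ _),
      ← dotProduct_mulVec, ← dotProduct_mulVec, mulVec_mulVec x P P, hP.2, mulVec_mulVec,
      mulVec_mulVec, sub_mulVec, dotProduct_sub, smul_mulVec, dotProduct_smul]
    simp [mul_assoc]
  by_cases hy : P *ᵥ x = 0
  · rw [key, hy]; simp
  obtain ⟨c, hc, h1, F, hF, h2⟩ := pure_dn' hP (P *ᵥ x) (by rw [mulVec_mulVec, hP.2]) hy
  have hre : 0 ≤ (star x ⬝ᵥ (P * R * P - s • P) *ᵥ x).re := by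
    rw [key, h1, h2, mul_smul_comm, trace_smul, smul_eq_mul, ← Complex.ofReal_pow,
      Complex.sub_re, Complex.re_ofReal_mul, ← Complex.ofReal_mul, Complex.ofReal_re]
    nlinarith [h F hF, sq_nonneg c]
  have him : (star x ⬝ᵥ (P * R * P - s • P) *ᵥ x).im = 0 := by
    simpa using hH.im_star_dotProduct_mulVec_self x
  exact Complex.le_def.2 ⟨by simpa using hre, by simpa using him.symm⟩

lemma tensor_bound {P R : Matrix n n ℂ} {Q R' : Matrix m m ℂ} (hP : IsProj P) (hQ : IsProj Q)
    (hR : R.PosSemidef) (hR' : R'.PosSemidef) {s s' : ℝ} (hs : 0 ≤ s)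
    (h : ∀ F, Dn P F → s ≤ ((R * F).trace).re) (h' : ∀ F, Dn Q F → s' ≤ ((R' * F).trace).re)
    (F : Matrix (n × m) (n × m) ℂ) (hF : Dn (P ⊗ₖ Q) F) :
    s * s' ≤ (((R ⊗ₖ R') * F).trace).re := by
  have hQRQ : (Q * R' * Q).PosSemidef := by
    have := hR'.conjTranspose_mul_mul_same Q
    rwa [hQ.1.eq] at this
  have k := kron_sub_psd (psd_rsmul (proj_psd hP) hs) hQRQ (compress hP hR h) (compress hQ hR' h')
  have t := tr_nonneg k hF.1
  have sup := support (proj_kron hP hQ) hF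
  have e1 : ((P * R * P) ⊗ₖ (Q * R' * Q) * F).trace = ((R ⊗ₖ R') * F).trace := by
    conv_rhs => rw [← sup]
    rw [mul_kronecker_mul, mul_kronecker_mul, mul_assoc, mul_assoc, trace_mul_comm]
    simp only [mul_assoc]
  have e2 : (((s • P) ⊗ₖ (s' • Q)) * F).trace = ((s * s' : ℝ) : ℂ) := by
    have : (P ⊗ₖ Q) * F = F := by
      conv_rhs => rw [← sup]
      conv_lhs => rw [← sup]
      rw [← mul_assoc, ← mul_assoc, (proj_kron hP hQ).2]
    rw [smul_kronecker, kronecker_smul, smul_smul, smul_mul_assoc, this, trace_smul, hF.2.2]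
    simp
  rw [sub_mul, trace_sub, e1, e2, Complex.sub_re, Complex.ofReal_re] at t
  linarith

end basic
end CQ
namespace CQ
section dual
set_option linter.unusedSectionVars false
variable {K n : Type*} [Fintype K] [Fintype n] [DecidableEq n]

/-- Separation set. -/
def SS (P : K → Matrix n n ℂ) : Set ((K → Matrix n n ℂ) × ℝ) :=
  {z | ∃ (F : K → Matrix n n ℂ) (T : Matrix n n ℂ), (∀ i, Dn (P i) (F i)) ∧ T.trace.re < z.2 ∧
    ∀ i, ((z.1 i + T - F i) + (z.1 i + T - F i)ᴴ).PosSemidef}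

lemma dn_convex {P F G : Matrix n n ℂ} (hF : Dn P F) (hG : Dn P G) {a b : ℝ} (ha : 0 ≤ a)
    (hb : 0 ≤ b) (hab : a + b = 1) : Dn P (a • F + b • G) := by
  refine ⟨(psd_rsmul hF.1 ha).add (psd_rsmul hG.1 hb), ?_, ?_⟩
  · have : P - (a • F + b • G) = a • (P - F) + b • (P - G) := by
      rw [smul_sub, smul_sub, sub_add_sub_comm, ← add_smul, hab, one_smul]
    rw [this]
    exact (psd_rsmul hF.2.1 ha).add (psd_rsmul hG.2.1 hb)
  · rw [trace_add, trace_smul, trace_smul, hF.2.2, hG.2.2, ← add_smul, hab, one_smul]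

lemma SS_convex (P : K → Matrix n n ℂ) : Convex ℝ (SS P) := by
  rintro ⟨Y, t⟩ ⟨F, T, hF, ht, h⟩ ⟨Y', t'⟩ ⟨F', T', hF', ht', h'⟩ a b ha hb hab
  refine ⟨fun i => a • F i + b • F' i, a • T + b • T',
    fun i => dn_convex (hF i) (hF' i) ha hb hab, ?_, fun i => ?_⟩
  · simp only [trace_add, trace_smul, Complex.add_re, Complex.real_smul, Complex.re_ofReal_mul,
      Prod.smul_mk, Prod.mk_add_mk, smul_eq_mul] at ht ht' ⊢
    rcases ha.eq_or_lt with rfl | ha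
    · have : b = 1 := by linarith
      subst this; simpa using ht'
    · nlinarith
  · have := (psd_rsmul (h i) ha).add (psd_rsmul (h' i) hb)
    convert this using 1
    simp only [Prod.smul_mk, Prod.mk_add_mk, Pi.add_apply, Pi.smul_apply, conjTranspose_add,
      conjTranspose_sub, conjTranspose_smul, star_trivial]
    module

open scoped Matrix.Norms.L2Operator MatrixOrder in
lemma norm_psd (D : Matrix n n ℂ) {δ : ℝ} (h : ‖D‖ ≤ δ) :
    ((D + δ • (1 : Matrix n n ℂ)) + (D + δ • (1 : Matrix n n ℂ))ᴴ).PosSemidef := by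
  have hs : IsSelfAdjoint (D + Dᴴ) := IsSelfAdjoint.add_star_self D
  have h1 := hs.neg_algebraMap_norm_le_self
  have h2 : ‖D + Dᴴ‖ ≤ 2 * δ := by
    refine (norm_add_le _ _).trans ?_
    have : ‖Dᴴ‖ = ‖D‖ := norm_star D
    linarith
  have h3 := (Matrix.le_iff.1 h1).add
    (psd_rsmul (PosSemidef.one (n := n) (R := ℂ)) (sub_nonneg.2 h2))
  have e : (D + δ • (1 : Matrix n n ℂ)) + (D + δ • (1 : Matrix n n ℂ))ᴴ =
      D + Dᴴ - -(algebraMap ℝ (Matrix n n ℂ)) ‖D + Dᴴ‖ +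
        (2 * δ - ‖D + Dᴴ‖) • (1 : Matrix n n ℂ) := by
    rw [Algebra.algebraMap_eq_smul_one, conjTranspose_add, conjTranspose_smul, star_trivial,
      conjTranspose_one]
    module
  rw [e]
  exact h3

open scoped Matrix.Norms.L2Operator in
lemma SS_open (P : K → Matrix n n ℂ) : IsOpen (SS P) := by
  rw [Metric.isOpen_iff]
  rintro ⟨Y, t⟩ ⟨F, T, hF, ht, h⟩
  simp only at ht h
  set N : ℝ := (Fintype.card n : ℝ)
  have hN : 0 ≤ N := Nat.cast_nonneg _
  set δ := (t - T.trace.re) / (N + 2)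
  have hδ : 0 < δ := div_pos (by linarith) (by linarith)
  have hδ' : δ * (N + 2) = t - T.trace.re := div_mul_cancel₀ _ (by linarith)
  refine ⟨δ, hδ, ?_⟩
  rintro ⟨Y', t'⟩ hz
  rw [Metric.mem_ball, Prod.dist_eq, max_lt_iff] at hz
  obtain ⟨h1, h2⟩ := hz
  simp only at h1 h2
  refine ⟨F, T + δ • 1, hF, ?_, fun i => ?_⟩
  · rw [Real.dist_eq, abs_lt] at h2
    simp only [trace_add, trace_smul, trace_one, Complex.add_re, Complex.real_smul,
      Complex.re_ofReal_mul, Complex.natCast_re]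
    change _ + δ * N < t'
    nlinarith
  · have h3 : ‖Y' i - Y i‖ ≤ δ := by
      rw [← dist_eq_norm]
      exact (dist_le_pi_dist Y' Y i).trans h1.le
    have := (h i).add (norm_psd _ h3)
    convert this using 1
    simp only [conjTranspose_add, conjTranspose_sub]
    abel

/-- Matrix representing a real functional. -/
lemma represent (f : Matrix n n ℂ →ₗ[ℝ] ℝ) :
    ∃ R : Matrix n n ℂ, ∀ X, ((R * X).trace).re = f X := by
  let Φ : Module.Dual ℂ (Matrix n n ℂ) := Module.Dual.extendRCLike (𝕜 := ℂ) f
  refine ⟨Matrix.of fun a b => Φ (Matrix.single b a 1), fun X => ?_⟩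
  have h1 : ((Matrix.of fun a b => Φ (Matrix.single b a 1)) * X).trace = Φ X := by
    conv_rhs => rw [Matrix.matrix_eq_sum_single X]
    simp only [map_sum, Matrix.trace, Matrix.diag, Matrix.mul_apply, Matrix.of_apply]
    rw [Finset.sum_comm]
    refine Finset.sum_congr rfl fun i _ => Finset.sum_congr rfl fun j _ => ?_
    have : Matrix.single i j (X i j) = X i j • Matrix.single i j (1 : ℂ) := by
      rw [Matrix.smul_single]; simp
    rw [this, map_smul, smul_eq_mul, mul_comm]
  rw [h1]
  exact Module.Dual.re_extendRCLike_apply (𝕜 := ℂ) f X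

lemma ext_re {A B : Matrix n n ℂ} (h : ∀ X, ((A * X).trace).re = ((B * X).trace).re) : A = B := by
  have h0 : ((A - B) * (A - B)ᴴ).trace = 0 := by
    have hp := (posSemidef_self_mul_conjTranspose (A - B)).trace_nonneg
    have hre : (((A - B) * (A - B)ᴴ).trace).re = 0 := by
      rw [sub_mul, trace_sub, Complex.sub_re, h, sub_self]
    exact Complex.ext hre (by simpa using (Complex.le_def.1 hp).2.symm)
  exact sub_eq_zero.1 (trace_mul_conjTranspose_self_eq_zero_iff.1 h0)

lemma rep_psd {R : Matrix n n ℂ}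
    (h : ∀ X : Matrix n n ℂ, (X + Xᴴ).PosSemidef → 0 ≤ ((R * X).trace).re) : R.PosSemidef := by
  have hH : R.IsHermitian := by
    have hanti : ∀ X : Matrix n n ℂ, X + Xᴴ = 0 → ((R * X).trace).re = 0 := by
      intro X hX
      have h1 := h X (by rw [hX]; exact .zero)
      have h2 := h (-X) (by
        rw [conjTranspose_neg, ← neg_add, hX, neg_zero]; exact .zero)
      rw [mul_neg, trace_neg, Complex.neg_re] at h2
      linarith
    apply ext_re
    intro X
    have h1 := hanti (X - Xᴴ) (by rw [conjTranspose_sub, conjTranspose_conjTranspose]; abel)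
    have h2 : ((Rᴴ * X).trace).re = ((R * Xᴴ).trace).re := by
      have : (Rᴴ * X).trace = star ((R * Xᴴ).trace) := by
        rw [← trace_conjTranspose, conjTranspose_mul, conjTranspose_conjTranspose, trace_mul_comm]
      rw [this]; simp
    rw [mul_sub, trace_sub, Complex.sub_re] at h1
    linarith
  refine .of_dotProduct_mulVec_nonneg hH fun x => ?_
  have key : star x ⬝ᵥ R *ᵥ x = (R * vecMulVec x (star x)).trace := by
    rw [mul_vecMulVec, trace_vecMulVec, dotProduct_comm]
  have hp := posSemidef_vecMulVec_self_star x
  have hre : 0 ≤ (star x ⬝ᵥ R *ᵥ x).re := by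
    rw [key]; exact h _ (hp.add hp.conjTranspose)
  have him : (star x ⬝ᵥ R *ᵥ x).im = 0 := by
    simpa using hH.im_star_dotProduct_mulVec_self x
  exact Complex.le_def.2 ⟨by simpa using hre, by simpa using him.symm⟩

lemma feas_bdd [Nonempty K] (P : K → Matrix n n ℂ) (T : Matrix n n ℂ) (F : K → Matrix n n ℂ)
    (h : ∀ i, Dn (P i) (F i) ∧ (T - F i).PosSemidef) : 1 ≤ T.trace.re := by
  obtain ⟨i⟩ := ‹Nonempty K›
  have h1 := (Complex.le_def.1 (h i).2.trace_nonneg).1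
  rw [trace_sub, (h i).1.2.2] at h1
  simpa using h1

/-- feasible values -/
def FV (P : K → Matrix n n ℂ) : Set ℝ := {x : ℝ | ∃ T : Matrix n n ℂ, x = T.trace.re ∧
    ∃ F : K → Matrix n n ℂ, ∀ i, Dn (P i) (F i) ∧ (T - F i).PosSemidef}

lemma sigma_eq (P : K → Matrix n n ℂ) : SigmaCQ P = sInf (FV P) := by
  unfold SigmaCQ FV Dn loe
  simp only [sub_zero, and_assoc]

lemma FV_lb [Nonempty K] (P : K → Matrix n n ℂ) : ∀ x ∈ FV P, 1 ≤ x := by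
  rintro x ⟨T, rfl, F, h⟩
  exact feas_bdd P T F h

lemma FV_nonempty (P : K → Matrix n n ℂ) (hP : ∀ i, IsProj (P i)) (hne : ∀ i, P i ≠ 0) :
    (FV P).Nonempty := by
  classical
  choose F hF using fun i => dn_nonempty (hP i) (hne i)
  refine ⟨_, ∑ i, F i, rfl, F, fun i => ⟨hF i, ?_⟩⟩
  rw [← Finset.sum_erase_eq_sub (Finset.mem_univ i)]
  exact posSemidef_sum _ fun j _ => (hF j).1

theorem strong [Nonempty K] (P : K → Matrix n n ℂ) (hP : ∀ i, IsProj (P i)) (hne : ∀ i, P i ≠ 0)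
    (s : ℝ) (hs : s < SigmaCQ P) :
    ∃ R : K → Matrix n n ℂ, (∀ i, (R i).PosSemidef) ∧ ∑ i, R i = 1 ∧
      ∀ F : K → Matrix n n ℂ, (∀ i, Dn (P i) (F i)) → s ≤ ∑ i, ((R i * F i).trace).re := by
  classical
  have hbdd : BddBelow (FV P) := ⟨1, FV_lb P⟩
  have hnot : ((0 : K → Matrix n n ℂ), s) ∉ SS P := by
    rintro ⟨F, T, hF, hT, h⟩
    simp only [Pi.zero_apply, zero_add] at hT h
    have hm : T.trace.re ∈ FV P := by
      refine ⟨(1 / 2 : ℝ) • (T + Tᴴ), ?_, F, fun i => ⟨hF i, ?_⟩⟩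
      · rw [trace_smul, trace_add, trace_conjTranspose, Complex.real_smul, Complex.re_ofReal_mul]
        simp; ring
      · have := psd_rsmul (h i) (show (0 : ℝ) ≤ 1 / 2 by norm_num)
        convert this using 1
        rw [conjTranspose_sub, (hF i).1.1.eq]
        module
    have := csInf_le hbdd hm
    rw [← sigma_eq] at this
    linarith
  let _ : NormedAddCommGroup (Matrix n n ℂ) := Matrix.instL2OpNormedAddCommGroup
  let _ : NormedSpace ℂ (Matrix n n ℂ) := Matrix.instL2OpNormedSpace
  obtain ⟨f, hf⟩ := geometric_hahn_banach_open_point (SS_convex P) (SS_open P) hnot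
  -- components
  let c : ℝ := f (0, 1)
  let φ : K → Matrix n n ℂ →ₗ[ℝ] ℝ := fun i =>
    f.toLinearMap ∘ₗ (LinearMap.inl ℝ (K → Matrix n n ℂ) ℝ) ∘ₗ
      (LinearMap.single ℝ (fun _ : K => Matrix n n ℂ) i)
  have hfφ : ∀ Y t, f (Y, t) = ∑ i, φ i (Y i) + t * c := by
    intro Y t
    have e1 : ((Y, t) : (K → Matrix n n ℂ) × ℝ) =
        ∑ i, ((Pi.single i (Y i), 0) : (K → Matrix n n ℂ) × ℝ) + t • ((0 : K → Matrix n n ℂ), (1 : ℝ)) := by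
      refine Prod.ext ?_ ?_
      · simp only [Prod.fst_add, Prod.fst_sum, Prod.smul_fst, smul_zero, add_zero]
        exact (Finset.univ_sum_single Y).symm
      · simp [Prod.snd_sum]
    rw [e1, map_add, map_sum, map_smul]
    rfl
  -- general inequality
  have hmain : ∀ (F : K → Matrix n n ℂ) (T : Matrix n n ℂ) (N : K → Matrix n n ℂ) (r : ℝ),
      (∀ i, Dn (P i) (F i)) → (∀ i, (N i + (N i)ᴴ).PosSemidef) → 0 < r →
      ∑ i, φ i (F i) - ∑ i, φ i T + ∑ i, φ i (N i) + (T.trace.re + r) * c < s * c := by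
    intro F T N r hF hN hr
    have := hf ((fun i => F i - T + N i), T.trace.re + r) ⟨F, T, hF, by simpa using hr, fun i => by
      have := hN i
      have e : F i - T + N i + T - F i = N i := by abel
      simp only [e]; exact this⟩
    rw [hfφ, hfφ] at this
    simpa [Finset.sum_add_distrib, Finset.sum_sub_distrib] using this
  choose F₀ hF₀ using fun i => dn_nonempty (hP i) (hne i)
  have hz : ∀ i : K, ((0 : Matrix n n ℂ) + (0 : Matrix n n ℂ)ᴴ).PosSemidef := fun i => by
    simpa using PosSemidef.zero (n := n) (R := ℂ)
  -- c < 0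
  have hcle : c < 0 := by
    obtain ⟨x, T, rfl, F, hTF⟩ := FV_nonempty P hP hne
    have h1 := hf (0, |T.trace.re| + |s| + 1) ⟨F, T, fun i => (hTF i).1, by
      have := le_abs_self T.trace.re
      have := abs_nonneg s
      simp only; linarith, fun i => by
      have := (hTF i).2
      simpa using this.add this.conjTranspose⟩
    rw [hfφ, hfφ] at h1
    simp only [Pi.zero_apply, map_zero, Finset.sum_const_zero, zero_add] at h1
    have := le_abs_self s
    have := abs_nonneg T.trace.re
    by_contra! hc
    nlinarith
  let g : K → Matrix n n ℂ →ₗ[ℝ] ℝ := fun i => (1 / c) • φ i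
  have hφg : ∀ i X, φ i X = c * g i X := by
    intro i X
    simp only [g, LinearMap.smul_apply, smul_eq_mul]
    field_simp [hcle.ne]
  have hmain' : ∀ (F : K → Matrix n n ℂ) (T : Matrix n n ℂ) (N : K → Matrix n n ℂ) (r : ℝ),
      (∀ i, Dn (P i) (F i)) → (∀ i, (N i + (N i)ᴴ).PosSemidef) → 0 < r →
      s < ∑ i, g i (F i) - ∑ i, g i T + ∑ i, g i (N i) + (T.trace.re + r) := by
    intro F T N r hF hN hr
    have := hmain F T N r hF hN hr
    simp only [hφg, ← Finset.mul_sum] at this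
    by_contra! hcon
    nlinarith
  clear hmain hfφ hf hφg
  clear_value g
  -- archimedean helper
  have arch : ∀ A x : ℝ, (∀ k : ℝ, 0 ≤ k → s < A + k * x) → 0 ≤ x := by
    intro A x h
    by_contra! hx
    have := h ((|A| + |s|) / (-x)) (div_nonneg (by positivity) (by linarith))
    have e : (|A| + |s|) / (-x) * x = -(|A| + |s|) := by
      rw [div_neg, neg_mul, div_mul_cancel₀ _ hx.ne]
    rw [e] at this
    linarith [le_abs_self A, neg_abs_le s]
  have hT : ∀ T : Matrix n n ℂ, ∑ i, g i T = T.trace.re := by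
    have h1 : ∀ T : Matrix n n ℂ, 0 ≤ T.trace.re - ∑ i, g i T := by
      intro T
      apply arch (∑ i, g i (F₀ i) + 1)
      intro k hk
      have := hmain' F₀ (k • T) (fun _ => 0) 1 hF₀ (fun i => hz i) one_pos
      simp only [map_smul, map_zero, Finset.sum_const_zero, smul_eq_mul, ← Finset.mul_sum,
        trace_smul, Complex.real_smul, Complex.re_ofReal_mul] at this
      linarith
    intro T
    have a := h1 T
    have b := h1 (-T)
    simp only [map_neg, trace_neg, Complex.neg_re, Finset.sum_neg_distrib] at b
    linarith
  have hN : ∀ i X, (X + Xᴴ).PosSemidef → 0 ≤ g i X := by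
    intro i X hX
    apply arch (∑ i, g i (F₀ i) + 1)
    intro k hk
    have := hmain' F₀ 0 (Pi.single i (k • X)) 1 hF₀ (fun j => by
      by_cases hj : j = i
      · subst hj
        have := psd_rsmul hX hk
        simpa [conjTranspose_smul, smul_add] using this
      · rw [Pi.single_eq_of_ne hj]; exact hz i) one_pos
    have e : ∑ j, g j ((Pi.single i (k • X) : K → Matrix n n ℂ) j) = k * g i X := by
      rw [Finset.sum_eq_single i]
      · simp
      · intro j _ hj; rw [Pi.single_eq_of_ne hj, map_zero]
      · simp
    rw [e] at this
    simp only [map_zero, Finset.sum_const_zero, trace_zero, Complex.zero_re] at this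
    linarith
  choose R hR using fun i => represent (g i)
  refine ⟨R, fun i => rep_psd fun X hX => by rw [hR]; exact hN i X hX, ?_, ?_⟩
  · apply ext_re
    intro X
    rw [Finset.sum_mul, trace_sum, Complex.re_sum, one_mul]
    simp only [hR]
    exact hT X
  · intro F hF
    simp only [hR]
    apply le_of_forall_pos_le_add
    intro r hr
    have := hmain' F 0 (fun _ => 0) r hF (fun i => hz i) hr
    simp only [map_zero, Finset.sum_const_zero, trace_zero, Complex.zero_re] at this
    linarith

theorem strong' [Nonempty K] (P : K → Matrix n n ℂ) (hP : ∀ i, IsProj (P i)) (hne : ∀ i, P i ≠ 0)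
    (s : ℝ) (hs : s < SigmaCQ P) :
    ∃ (R : K → Matrix n n ℂ) (v : K → ℝ), (∀ i, (R i).PosSemidef) ∧ ∑ i, R i = 1 ∧ (∀ i, 0 ≤ v i) ∧
      (∀ i F, Dn (P i) F → v i ≤ ((R i * F).trace).re) ∧ s ≤ ∑ i, v i := by
  obtain ⟨R, hR, hR1, h⟩ := strong P hP hne s hs
  let V : K → Set ℝ := fun i => {x | ∃ F, Dn (P i) F ∧ x = ((R i * F).trace).re}
  have hV0 : ∀ i, ∀ x ∈ V i, 0 ≤ x := by
    rintro i x ⟨F, hF, rfl⟩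
    exact tr_nonneg (hR i) hF.1
  have hVne : ∀ i, (V i).Nonempty := by
    intro i
    obtain ⟨F, hF⟩ := dn_nonempty (hP i) (hne i)
    exact ⟨_, F, hF, rfl⟩
  refine ⟨R, fun i => sInf (V i), hR, hR1, fun i => le_csInf (hVne i) (hV0 i),
    fun i F hF => csInf_le ⟨0, hV0 i⟩ ⟨F, hF, rfl⟩, ?_⟩
  have hN : 0 < (Fintype.card K : ℝ) := by exact_mod_cast Fintype.card_pos
  apply le_of_forall_pos_le_add
  intro ε hε
  have : ∀ i, ∃ F, Dn (P i) F ∧ ((R i * F).trace).re < sInf (V i) + ε / Fintype.card K := by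
    intro i
    obtain ⟨x, ⟨F, hF, rfl⟩, hx⟩ := exists_lt_of_csInf_lt (hVne i)
      (lt_add_of_pos_right (sInf (V i)) (div_pos hε hN))
    exact ⟨F, hF, hx⟩
  choose F hF hlt using this
  calc s ≤ _ := h F hF
    _ ≤ ∑ i, (sInf (V i) + ε / Fintype.card K) := Finset.sum_le_sum fun i _ => (hlt i).le
    _ = _ := by
      rw [Finset.sum_add_distrib, Finset.sum_const, Finset.card_univ, nsmul_eq_mul,
        mul_div_cancel₀ _ hN.ne']

end dual
end CQ
open Kronecker in
/-- The cq semidefinite covering number is multiplicative under tensor products. -/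
theorem sigmaCQ_multiplicative
    {J B₂ : Type*} [Fintype J] [Fintype B₂] [DecidableEq B₂]
    [Nonempty I] [Nonempty J] [Nonempty B] [Nonempty B₂]
    (P : I → Matrix B B ℂ) (Q : J → Matrix B₂ B₂ ℂ)
    (hP : ∀ i, IsProj (P i)) (hQ : ∀ j, IsProj (Q j))
    (hPne : ∀ i, P i ≠ 0) (hQne : ∀ j, Q j ≠ 0) :
    SigmaCQ (fun ij : I × J => P ij.1 ⊗ₖ Q ij.2) = SigmaCQ P * SigmaCQ Q := by
  have neP := CQ.FV_nonempty P hP hPne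
  have neQ := CQ.FV_nonempty Q hQ hQne
  have hmem : ∀ x ∈ CQ.FV P, ∀ y ∈ CQ.FV Q,
      x * y ∈ CQ.FV (fun ij : I × J => P ij.1 ⊗ₖ Q ij.2) := by
    rintro x ⟨T, rfl, F, hF⟩ y ⟨T', rfl, F', hF'⟩
    have hT : T.PosSemidef := by
      obtain ⟨i⟩ := ‹Nonempty I›
      simpa using (hF i).2.add (hF i).1.1
    have hT' : T'.PosSemidef := by
      obtain ⟨i⟩ := ‹Nonempty J›
      simpa using (hF' i).2.add (hF' i).1.1
    refine ⟨T ⊗ₖ T', ?_, fun ij => F ij.1 ⊗ₖ F' ij.2, fun ij =>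
      ⟨CQ.dn_kron (hQ _) (hF _).1 (hF' _).1,
        CQ.kron_sub_psd (hF _).1.1 hT' (hF _).2 (hF' _).2⟩⟩
    have h1 := (Complex.le_def.1 hT.trace_nonneg).2
    rw [trace_kronecker, Complex.mul_re, ← h1]
    simp
  have ne12 : (CQ.FV (fun ij : I × J => P ij.1 ⊗ₖ Q ij.2)).Nonempty := by
    obtain ⟨x, hx⟩ := neP
    obtain ⟨y, hy⟩ := neQ
    exact ⟨_, hmem x hx y hy⟩
  have posP : 1 ≤ SigmaCQ P := by rw [CQ.sigma_eq]; exact le_csInf neP (CQ.FV_lb P)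
  have posQ : 1 ≤ SigmaCQ Q := by rw [CQ.sigma_eq]; exact le_csInf neQ (CQ.FV_lb Q)
  have pos12 : 1 ≤ SigmaCQ (fun ij : I × J => P ij.1 ⊗ₖ Q ij.2) := by
    rw [CQ.sigma_eq]; exact le_csInf ne12 (CQ.FV_lb _)
  apply le_antisymm
  · have h1 : ∀ x ∈ CQ.FV P, ∀ y ∈ CQ.FV Q,
        SigmaCQ (fun ij : I × J => P ij.1 ⊗ₖ Q ij.2) ≤ x * y := by
      intro x hx y hy
      rw [CQ.sigma_eq]
      exact csInf_le ⟨1, CQ.FV_lb _⟩ (hmem x hx y hy)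
    have h2 : ∀ y ∈ CQ.FV Q,
        SigmaCQ (fun ij : I × J => P ij.1 ⊗ₖ Q ij.2) ≤ SigmaCQ P * y := by
      intro y hy
      have hy0 : 0 < y := lt_of_lt_of_le one_pos (CQ.FV_lb Q y hy)
      rw [← div_le_iff₀ hy0, CQ.sigma_eq P]
      exact le_csInf neP fun x hx => (div_le_iff₀ hy0).2 (h1 x hx y hy)
    have hp0 : 0 < SigmaCQ P := by linarith
    rw [← div_le_iff₀' hp0, CQ.sigma_eq Q]
    exact le_csInf neQ fun y hy => (div_le_iff₀' hp0).2 (h2 y hy)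
  · apply mul_le_of_forall_lt_of_nonneg (by linarith) (by linarith)
    intro s hs0 hs s' hs0' hs'
    obtain ⟨R, v, hR, hR1, hv, hRv, hsv⟩ := CQ.strong' P hP hPne s hs
    obtain ⟨R', v', hR', hR1', hv', hRv', hsv'⟩ := CQ.strong' Q hQ hQne s' hs'
    rw [CQ.sigma_eq]
    refine le_csInf ne12 ?_
    rintro _ ⟨T, rfl, F, hF⟩
    have hone : ∑ ij : I × J, R ij.1 ⊗ₖ R' ij.2 = 1 := by
      rw [← one_kronecker_one, ← hR1, ← hR1', Fintype.sum_prod_type]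
      ext a b
      simp only [Matrix.sum_apply, kroneckerMap_apply, Finset.sum_mul_sum]
    calc s * s' ≤ (∑ i, v i) * ∑ j, v' j := mul_le_mul hsv hsv' hs0' (hs0.trans hsv)
      _ = ∑ ij : I × J, v ij.1 * v' ij.2 := by
        rw [Finset.sum_mul_sum, Fintype.sum_prod_type]
      _ ≤ ∑ ij : I × J, (((R ij.1 ⊗ₖ R' ij.2) * F ij).trace).re :=
        Finset.sum_le_sum fun ij _ => CQ.tensor_bound (hP _) (hQ _) (hR _) (hR' _) (hv _)
          (hRv _) (hRv' _) _ (hF ij).1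
      _ ≤ ∑ ij : I × J, (((R ij.1 ⊗ₖ R' ij.2) * T).trace).re := by
        refine Finset.sum_le_sum fun ij _ => ?_
        have := CQ.tr_nonneg ((hR ij.1).kronecker (hR' ij.2)) (hF ij).2
        rw [mul_sub, trace_sub, Complex.sub_re] at this
        linarith
      _ = T.trace.re := by
        rw [← Complex.re_sum, ← trace_sum, ← Finset.sum_mul, hone, one_mul]
end
end

section
/- Let (P_i)_{i∈I} be a cq-graph on a nonempty finite input set I with output space ℂ^B, with every P_i nonzero. Then the semidefinite packing number satisfies A({P_i}) > 1 if and only if the intersection of the ranges of the P_i is trivial, i.e. if and only if every vector v : B → ℂ with P_i·v = v for all i ∈ I is zero. -/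
open Matrix BigOperators
open scoped ComplexOrder

noncomputable section

variable {I B : Type*} [Fintype I] [Fintype B] [DecidableEq B]

lemma aux_proj_psd_s13 {n : Type*} [Fintype n] {M : Matrix n n ℂ} (h : IsProj M) : M.PosSemidef := by
  have := Matrix.posSemidef_conjTranspose_mul_self M
  rwa [h.1.eq, h.2] at this

lemma aux_proj_compl {n : Type*} [Fintype n] [DecidableEq n] {M : Matrix n n ℂ} (h : IsProj M) :
    (1 - M).PosSemidef := by
  apply aux_proj_psd_s13
  refine ⟨Matrix.isHermitian_one.sub h.1, ?_⟩
  simp [mul_sub, sub_mul, h.2]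

lemma aux_posDef {n : Type*} [Fintype n] [DecidableEq n] [Nonempty n] {A : Matrix n n ℂ}
    (h : A.PosDef) : ∃ c : ℝ, 0 < c ∧ (A - c • (1 : Matrix n n ℂ)).PosSemidef := by
  obtain ⟨i0, hi0⟩ := Finite.exists_min h.1.eigenvalues
  refine ⟨h.1.eigenvalues i0, h.eigenvalues_pos i0, ?_⟩
  set c := h.1.eigenvalues i0
  set U : Matrix n n ℂ := (h.1.eigenvectorUnitary : Matrix n n ℂ) with hU
  have hUU : U * Uᴴ = 1 := by
    rw [← Matrix.star_eq_conjTranspose]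
    exact Unitary.mul_star_self_of_mem h.1.eigenvectorUnitary.2
  have key : A - c • (1 : Matrix n n ℂ) =
      U * (diagonal (fun i => ((h.1.eigenvalues i - c : ℝ) : ℂ))) * Uᴴ := by
    have hs := h.1.spectral_theorem
    rw [Unitary.conjStarAlgAut_apply] at hs
    have hd : diagonal (fun i => ((h.1.eigenvalues i - c : ℝ) : ℂ)) =
        diagonal (RCLike.ofReal ∘ h.1.eigenvalues) - c • (1 : Matrix n n ℂ) := by
      ext i j
      by_cases hij : i = j
      · subst hij; simp
      · simp [hij]
    rw [hd, mul_sub, sub_mul, mul_smul_comm, smul_mul_assoc, mul_one, hUU]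
    congr 1
  rw [key]
  apply Matrix.PosSemidef.mul_mul_conjTranspose_same
  apply Matrix.PosSemidef.diagonal
  intro i
  simpa using hi0 i

lemma aux_q {n : Type*} [Fintype n] [DecidableEq n] {I : Type*} [Fintype I]
    (P : I → Matrix n n ℂ) (s : I → ℝ) (v : n → ℂ)
    (h : loe (∑ i, s i • P i) 1) :
    ∑ i, s i * (star v ⬝ᵥ (P i *ᵥ v)).re ≤ (star v ⬝ᵥ v).re := by
  have := (Complex.le_def.1 (h.dotProduct_mulVec_nonneg v)).1
  simp only [Matrix.sub_mulVec, Matrix.one_mulVec, dotProduct_sub, Matrix.sum_mulVec,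
    dotProduct_sum, Matrix.smul_mulVec, dotProduct_smul] at this
  simp at this
  exact this

lemma aux_vpos {n : Type*} [Fintype n] {v : n → ℂ} (h : v ≠ 0) : 0 < (star v ⬝ᵥ v).re := by
  have : 0 < star v ⬝ᵥ v := Matrix.dotProduct_star_self_pos_iff.2 h
  exact (Complex.lt_def.1 this).1

/-- The semidefinite packing number of a cq-graph exceeds one iff the intersection of
the ranges of the projections is trivial. -/
theorem aramCQ_gt_one_iff [Nonempty I] [Nonempty B]
    (P : I → Matrix B B ℂ) (hP : ∀ i, IsProj (P i)) (hne : ∀ i, P i ≠ 0) :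
    1 < AramCQ P ↔ ∀ v : B → ℂ, (∀ i, P i *ᵥ v = v) → v = 0 := by
  constructor
  · intro h v hv
    by_contra hv0
    refine absurd h (not_lt.2 ?_)
    apply csSup_le
    · exact ⟨0, 0, by simp, by simp, by simpa [loe] using Matrix.PosSemidef.one⟩
    · rintro x ⟨s, hs, rfl, hl⟩
      have := aux_q P s v hl
      simp only [hv, ← Finset.sum_mul] at this
      have hp := aux_vpos hv0
      nlinarith
  · intro h
    have hbdd : BddAbove { x : ℝ | ∃ s : I → ℝ, (∀ i, 0 ≤ s i) ∧ x = ∑ i, s i ∧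
        loe (∑ i, s i • P i) 1 } := by
      refine ⟨∑ i : I, 1, ?_⟩
      rintro x ⟨s, hs, rfl, hl⟩
      refine Finset.sum_le_sum fun i _ => ?_
      obtain ⟨w, hw⟩ : ∃ w, P i *ᵥ w ≠ 0 := by
        by_contra! hc
        apply hne i
        apply Matrix.ext_of_mulVec_single
        intro j
        simp only [hc, Matrix.zero_mulVec]
      have hf : P i *ᵥ (P i *ᵥ w) = P i *ᵥ w := by rw [Matrix.mulVec_mulVec, (hP i).2]
      have h1 := aux_q P s (P i *ᵥ w) hl
      have h2 := Finset.single_le_sum (f := fun j => s j *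
        (star (P i *ᵥ w) ⬝ᵥ (P j *ᵥ (P i *ᵥ w))).re) (fun j _ => mul_nonneg (hs j)
          (Complex.le_def.1 ((aux_proj_psd_s13 (hP j)).dotProduct_mulVec_nonneg _)).1)
          (Finset.mem_univ i)
      simp only [hf] at h2
      have hp := aux_vpos hw
      nlinarith
    have hA : (∑ i, (1 - P i)).PosSemidef :=
      Matrix.posSemidef_sum _ fun i _ => aux_proj_compl (hP i)
    have hD : (∑ i, (1 - P i)).PosDef := by
      refine Matrix.PosDef.of_dotProduct_mulVec_pos hA.1 fun x hx => ?_
      refine lt_of_le_of_ne (hA.dotProduct_mulVec_nonneg x) fun h0 => hx (h x fun i => ?_)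
      rw [Matrix.sum_mulVec, dotProduct_sum, eq_comm, Finset.sum_eq_zero_iff_of_nonneg
        (fun i _ => (aux_proj_compl (hP i)).dotProduct_mulVec_nonneg x)] at h0
      have := ((aux_proj_compl (hP i)).dotProduct_mulVec_zero_iff x).1 (h0 i (Finset.mem_univ i))
      rw [Matrix.sub_mulVec, Matrix.one_mulVec, sub_eq_zero] at this
      exact this.symm
    obtain ⟨c, hc, hcp⟩ := aux_posDef hD
    set n : ℝ := ((Fintype.card I : ℕ) : ℝ) with hn
    have hn0 : 0 < n := by rw [hn]; exact_mod_cast Fintype.card_pos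
    have hsum : (∑ i, (1 - P i)) = n • (1 : Matrix B B ℂ) - ∑ i, P i := by
      rw [Finset.sum_sub_distrib, hn]
      simp [Nat.cast_smul_eq_nsmul]
    rw [hsum] at hA hcp
    refine lt_of_lt_of_le (b := 1 + c / n) (by have := div_pos hc hn0; linarith) ?_
    refine le_csSup hbdd ⟨fun _ => (1 + c / n) / n, fun _ => by positivity, ?_, ?_⟩
    · simp only [Finset.sum_const, Finset.card_univ, nsmul_eq_mul, ← hn]
      field_simp
    · unfold loe
      have h1 := hcp.add (hA.smul (div_pos hc hn0).le)
      have h2 := h1.smul (inv_pos.2 hn0).le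
      convert h2 using 1
      rw [← Finset.smul_sum]
      generalize ∑ i, P i = S
      have : n ≠ 0 := hn0.ne'
      match_scalars <;> field_simp <;> ring
end
end

section
/- Let A and B be nonempty finite types and let P be a projection on ℂ^(A×B). If there exists n ≥ 1 such that Υ(P^⊠n) > 1, where P^⊠n is the n-fold product projection on ℂ^((Fin n → A)×(Fin n → B)) with entries P^⊠n ((a,b),(a',b')) = ∏_k P ((a k, b k),(a' k, b' k)), then the partial trace over A of the complementary projection, Tr_A(1_{A×B} − P), is positive definite. -/
open Matrix Kronecker BigOperators
open scoped ComplexOrder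

noncomputable section

variable {A B : Type*} [Fintype A] [Fintype B] [DecidableEq A] [DecidableEq B]

/-- Partial trace over `A`. -/
def trA (M : Matrix (A × B) (A × B) ℂ) : Matrix B B ℂ :=
  Matrix.of fun b b' => ∑ a, M (a, b) (a, b')

/-- Partial trace over `B`. -/
def trB (M : Matrix (A × B) (A × B) ℂ) : Matrix A A ℂ :=
  Matrix.of fun a a' => ∑ b, M (a, b) (a', b)

/-- `P` supports a quantum channel: there is a PSD `J` supported on `P` with `Tr_B J = 1`. -/
def SupportsChannel (P : Matrix (A × B) (A × B) ℂ) : Prop :=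
  ∃ J : Matrix (A × B) (A × B) ℂ, J.PosSemidef ∧ P * J = J ∧ trB J = 1

/-- One-shot no-signalling assisted independence number (primal SDP). -/
def Upsilon (P : Matrix (A × B) (A × B) ℂ) : ℝ :=
  sSup { x : ℝ | ∃ S : Matrix A A ℂ, S.IsHermitian ∧ x = S.trace.re ∧
    ∃ E : Matrix (A × B) (A × B) ℂ,
      loe 0 E ∧ loe E (S ⊗ₖ (1 : Matrix B B ℂ)) ∧ trA E = 1 ∧
      (P * (S ⊗ₖ (1 : Matrix B B ℂ) - E)).trace = 0 }

/-- The `n`-fold tensor power of a non-commutative bipartite graph. -/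
def powP (P : Matrix (A × B) (A × B) ℂ) (n : ℕ) :
    Matrix ((Fin n → A) × (Fin n → B)) ((Fin n → A) × (Fin n → B)) ℂ :=
  Matrix.of fun x y => ∏ k, P (x.1 k, x.2 k) (y.1 k, y.2 k)


def embv {A B : Type*} [DecidableEq A] (a : A) (v : B → ℂ) : A × B → ℂ :=
  fun x => (if x.1 = a then 1 else 0) * v x.2

lemma sum_pow_aux {A B : Type*} [Fintype A] [Fintype B] [DecidableEq A] [DecidableEq B]
    (n : ℕ) (g : Fin n → A × B → ℂ) :
    ∑ x : (Fin n → A) × (Fin n → B), ∏ k, g k (x.1 k, x.2 k) = ∏ k, ∑ y, g k y := by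
  rw [Fintype.prod_sum]
  exact (Fintype.sum_equiv (Equiv.arrowProdEquivProdArrow (Fin n) (fun _ => A) (fun _ => B)) _ _
    (fun x => rfl)).symm

lemma trA_quad {A B : Type*} [Fintype A] [Fintype B] [DecidableEq A] [DecidableEq B]
    (M : Matrix (A × B) (A × B) ℂ) (v : B → ℂ) :
    star v ⬝ᵥ (trA M *ᵥ v) = ∑ a, star (embv a v) ⬝ᵥ (M *ᵥ (embv a v)) := by
  simp only [dotProduct, mulVec, trA, embv, Fintype.sum_prod_type, Matrix.of_apply, Pi.star_apply,
    star_mul', apply_ite star, star_one, star_zero, ite_mul, mul_ite, one_mul, zero_mul, mul_zero]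
  simp only [Finset.sum_ite_irrel, Finset.sum_const_zero, Finset.sum_ite_eq', Finset.sum_ite_eq,
    Finset.mem_univ, if_true, Finset.mul_sum, Finset.sum_mul]
  rw [Finset.sum_comm' (t' := Finset.univ) (s' := fun _ => Finset.univ) (by simp)]
  rw [Finset.sum_comm]
  conv_rhs => rw [Finset.sum_comm]
  refine Finset.sum_congr rfl fun b _ => ?_
  rw [Finset.sum_comm]

open scoped MatrixOrder Matrix.Norms.L2Operator in
lemma PSD_mul_zero {m : Type*} [Fintype m] [DecidableEq m] (T Q : Matrix m m ℂ)
    (hT : T.PosSemidef) (hQ : IsProj Q) (h : (Q * T).trace = 0) : T * Q = 0 := by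
  obtain ⟨C, rfl⟩ := CStarAlgebra.nonneg_iff_eq_star_mul_self.mp hT.nonneg
  rw [star_eq_conjTranspose] at h ⊢
  have h1 : ((C * Q) * (C * Q)ᴴ).trace = 0 := by
    rw [← h, conjTranspose_mul, hQ.1.eq, Matrix.mul_assoc, ← Matrix.mul_assoc Q Q, hQ.2,
      Matrix.trace_mul_comm, Matrix.mul_assoc]
  rw [Matrix.trace_mul_conjTranspose_self_eq_zero_iff] at h1
  rw [Matrix.mul_assoc, h1, Matrix.mul_zero]

lemma powP_proj {A B : Type*} [Fintype A] [Fintype B] [DecidableEq A] [DecidableEq B]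
    (P : Matrix (A × B) (A × B) ℂ) (hP : IsProj P) (n : ℕ) : IsProj (powP P n) := by
  constructor
  · ext x y
    simp only [powP, conjTranspose_apply, of_apply, star_prod]
    exact Finset.prod_congr rfl fun k _ => hP.1.apply _ _
  · ext x y
    simp only [powP, mul_apply, of_apply, ← Finset.prod_mul_distrib]
    rw [sum_pow_aux n (fun k z => P (x.1 k, x.2 k) z * P z (y.1 k, y.2 k))]
    refine Finset.prod_congr rfl fun k _ => ?_
    rw [← mul_apply, hP.2]

lemma powP_emb {A B : Type*} [Fintype A] [Fintype B] [DecidableEq A] [DecidableEq B]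
    (P : Matrix (A × B) (A × B) ℂ) (v : B → ℂ) (h : ∀ a, P *ᵥ embv a v = embv a v) (n : ℕ)
    (a : Fin n → A) :
    powP P n *ᵥ embv a (fun b => ∏ k, v (b k)) = embv a (fun b => ∏ k, v (b k)) := by
  have key : ∀ x : (Fin n → A) × (Fin n → B), embv a (fun b => ∏ k, v (b k)) x
      = ∏ k, embv (a k) v (x.1 k, x.2 k) := by
    intro x
    simp only [embv, Finset.prod_mul_distrib]
    congr 1
    rw [Finset.prod_ite_zero]
    simp [funext_iff]
  ext x
  simp only [mulVec, dotProduct, key, powP, of_apply, ← Finset.prod_mul_distrib]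
  rw [sum_pow_aux n (fun k z => P (x.1 k, x.2 k) z * embv (a k) v z)]
  refine Finset.prod_congr rfl fun k _ => ?_
  exact congrFun (h (a k)) _

lemma trace_one {A B : Type*} [Fintype A] [Fintype B] [DecidableEq A] [DecidableEq B]
    (Q : Matrix (A × B) (A × B) ℂ) (hQ : IsProj Q) (w : B → ℂ) (hw : w ≠ 0)
    (h : ∀ a, Q *ᵥ embv a w = embv a w) (S : Matrix A A ℂ) (E : Matrix (A × B) (A × B) ℂ)
    (hE : loe E (S ⊗ₖ (1 : Matrix B B ℂ))) (hE1 : trA E = 1)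
    (ht : (Q * (S ⊗ₖ (1 : Matrix B B ℂ) - E)).trace = 0) : S.trace = 1 := by
  have h0 := PSD_mul_zero _ Q hE hQ ht
  have h1 := trA_quad (S ⊗ₖ (1 : Matrix B B ℂ) - E) w
  have h2 : ∀ a, (S ⊗ₖ (1 : Matrix B B ℂ) - E) *ᵥ embv a w = 0 := by
    intro a
    rw [← h a, mulVec_mulVec, h0, zero_mulVec]
  have h3 : trA (S ⊗ₖ (1 : Matrix B B ℂ) - E) = (S.trace - 1) • (1 : Matrix B B ℂ) := by
    rw [sub_smul, one_smul, ← hE1]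
    ext b b'
    simp [trA, Matrix.trace, Finset.sum_mul, kroneckerMap_apply, Finset.sum_sub_distrib]
  simp only [h2, h3, dotProduct_zero, Finset.sum_const_zero, smul_mulVec, one_mulVec,
    dotProduct_smul, smul_eq_mul, mul_eq_zero, dotProduct_star_self_eq_zero] at h1
  rcases h1 with h1 | h1
  · exact sub_eq_zero.1 h1
  · exact absurd (by simpa using h1) hw

/-- If some tensor power of `P` has no-signalling assisted independence number
greater than one, then `Tr_A (1 - P)` is positive definite. -/
theorem feasibility_necessary [Nonempty A] [Nonempty B]
    (P : Matrix (A × B) (A × B) ℂ) (hP : IsProj P)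
    (h : ∃ n : ℕ, 1 ≤ n ∧ 1 < Upsilon (powP P n)) :
    (trA (1 - P)).PosDef := by
  have hR : (1 - P).PosSemidef := by
    have e : (1 - P) = (1 - P)ᴴ * (1 - P) := by
      rw [conjTranspose_sub, conjTranspose_one, hP.1.eq, Matrix.sub_mul, Matrix.mul_sub, Matrix.mul_sub, hP.2]
      simp
    rw [e]
    exact posSemidef_conjTranspose_mul_self _
  have hnn : ∀ (v : B → ℂ) (a : A), 0 ≤ star (embv a v) ⬝ᵥ ((1 - P) *ᵥ (embv a v)) :=
    fun v a => hR.dotProduct_mulVec_nonneg _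
  refine Matrix.PosDef.of_dotProduct_mulVec_pos ?_ ?_
  · ext b b'
    simp only [trA, conjTranspose_apply, of_apply, star_sum]
    exact Finset.sum_congr rfl fun a _ => hR.1.apply _ _
  intro v hv
  rw [trA_quad]
  refine lt_of_le_of_ne (Finset.sum_nonneg fun a _ => hnn v a) fun h0 => ?_
  have h1 : ∀ a, P *ᵥ embv a v = embv a v := by
    intro a
    have := (Finset.sum_eq_zero_iff_of_nonneg (fun a _ => hnn v a)).1 h0.symm a (Finset.mem_univ a)
    rw [hR.dotProduct_mulVec_zero_iff, sub_mulVec, one_mulVec, sub_eq_zero] at this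
    exact this.symm
  obtain ⟨n, -, hn⟩ := h
  refine absurd hn (not_lt.2 ?_)
  refine Real.sSup_le ?_ zero_le_one
  rintro x ⟨S, -, rfl, E, -, hE, hE1, ht⟩
  have hw : (fun b : Fin n → B => ∏ k, v (b k)) ≠ 0 := by
    obtain ⟨b, hb⟩ := Function.ne_iff.1 hv
    intro h
    have := congrFun h (fun _ => b)
    simp only [Finset.prod_const, Pi.zero_apply] at this
    exact hb (eq_zero_of_pow_eq_zero this)
  have := trace_one (powP P n) (powP_proj P hP n) _ hw (powP_emb P v h1 n) S E hE hE1 ht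
  simp [this]
end
end

section
/- Let A and B be nonempty finite types, I a nonempty finite index set, and (E_i)_{i∈I} a family of B×A complex matrices such that ∑_i E_iᴴ·E_i is positive definite. Define Aram = sup { Re(trace R) : R a positive semidefinite A×A matrix with ∑_i E_i·R·E_iᴴ ≤ 1_B } and Âram = inf { c : c real, and there exists a positive semidefinite A×A matrix ρ with trace(ρ) = 1 and ∑_i E_i·ρ·E_iᴴ ≤ c·1_B } (the minimum over density matrices ρ of the largest eigenvalue of ∑_i E_i·ρ·E_iᴴ). Then Aram · Âram = 1. -/
open Matrix Kronecker BigOperators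
open scoped ComplexOrder

noncomputable section

variable {A B : Type*} [Fintype A] [Fintype B] [DecidableEq A] [DecidableEq B]

theorem aux_upper {n : Type*} [Fintype n] [DecidableEq n] {N : Matrix n n ℂ}
    (hN : N.IsHermitian) (c : ℝ) (h : ∀ i, hN.eigenvalues i ≤ c) :
    (c • (1 : Matrix n n ℂ) - N).PosSemidef := by
  set U : Matrix n n ℂ := hN.eigenvectorUnitary.1 with hU
  have hUU : U * Uᴴ = 1 := Unitary.mul_star_self_of_mem hN.eigenvectorUnitary.2
  have h1 : N = U * diagonal (RCLike.ofReal ∘ hN.eigenvalues) * Uᴴ := by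
    have := hN.spectral_theorem
    rw [Unitary.conjStarAlgAut_apply] at this
    exact this
  have h2 : c • (1 : Matrix n n ℂ) - N
      = U * (diagonal (fun i => ((c - hN.eigenvalues i : ℝ) : ℂ))) * Uᴴ := by
    have : (diagonal (fun i => ((c - hN.eigenvalues i : ℝ) : ℂ)))
        = c • (1 : Matrix n n ℂ) - diagonal (RCLike.ofReal ∘ hN.eigenvalues) := by
      ext i j
      by_cases hij : i = j <;> simp [hij, Matrix.one_apply]
    rw [this, Matrix.mul_sub, Matrix.sub_mul, ← h1]
    simp [hUU]
  rw [h2]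
  refine (PosSemidef.diagonal ?_).mul_mul_conjTranspose_same U
  intro i
  simpa using h i

theorem aux_lower {n : Type*} [Fintype n] [DecidableEq n] {N : Matrix n n ℂ}
    (hN : N.IsHermitian) (c : ℝ) (h : ∀ i, c ≤ hN.eigenvalues i) :
    (N - c • (1 : Matrix n n ℂ)).PosSemidef := by
  set U : Matrix n n ℂ := hN.eigenvectorUnitary.1 with hU
  have hUU : U * Uᴴ = 1 := Unitary.mul_star_self_of_mem hN.eigenvectorUnitary.2
  have h1 : N = U * diagonal (RCLike.ofReal ∘ hN.eigenvalues) * Uᴴ := by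
    have := hN.spectral_theorem
    rw [Unitary.conjStarAlgAut_apply] at this
    exact this
  have h2 : N - c • (1 : Matrix n n ℂ)
      = U * (diagonal (fun i => ((hN.eigenvalues i - c : ℝ) : ℂ))) * Uᴴ := by
    have : (diagonal (fun i => ((hN.eigenvalues i - c : ℝ) : ℂ)))
        = diagonal (RCLike.ofReal ∘ hN.eigenvalues) - c • (1 : Matrix n n ℂ) := by
      ext i j
      by_cases hij : i = j <;> simp [hij, Matrix.one_apply]
    rw [this, Matrix.mul_sub, Matrix.sub_mul, ← h1]
    simp [hUU]
  rw [h2]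
  refine (PosSemidef.diagonal ?_).mul_mul_conjTranspose_same U
  intro i
  simpa using h i

theorem aux_trace_s16 {n : Type*} [Fintype n] [DecidableEq n] {M N : Matrix n n ℂ}
    (hM : M.PosSemidef) (hN : N.PosSemidef) : 0 ≤ (M * N).trace := by
  open scoped MatrixOrder in
  obtain ⟨X, hX⟩ := CStarAlgebra.nonneg_iff_eq_star_mul_self.mp hN.nonneg
  rw [hX, ← Matrix.mul_assoc, Matrix.trace_mul_comm, ← Matrix.mul_assoc]
  exact (hM.mul_mul_conjTranspose_same X).trace_nonneg

/-- The semidefinite packing number expressed via Kraus operators is the reciprocal of the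
minimax value `min_ρ λ_max (∑ E_i ρ E_iᴴ)`. -/
theorem aram_reciprocal_minimax
    {I : Type*} [Fintype I] [Nonempty I] [Nonempty A] [Nonempty B]
    (E : I → Matrix B A ℂ)
    (hpd : (∑ i, (E i)ᴴ * E i).PosDef) :
    sSup { x : ℝ | ∃ R : Matrix A A ℂ, R.PosSemidef ∧ x = R.trace.re ∧
        loe (∑ i, E i * R * (E i)ᴴ) 1 } *
      sInf { c : ℝ | ∃ ρ : Matrix A A ℂ, ρ.PosSemidef ∧ ρ.trace = 1 ∧
        loe (∑ i, E i * ρ * (E i)ᴴ) (c • (1 : Matrix B B ℂ)) } = 1 := by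
  classical
  set S := { x : ℝ | ∃ R : Matrix A A ℂ, R.PosSemidef ∧ x = R.trace.re ∧
        loe (∑ i, E i * R * (E i)ᴴ) 1 } with hS
  set T := { c : ℝ | ∃ ρ : Matrix A A ℂ, ρ.PosSemidef ∧ ρ.trace = 1 ∧
        loe (∑ i, E i * ρ * (E i)ᴴ) (c • (1 : Matrix B B ℂ)) } with hT
  have hlin : ∀ (r : ℝ) (R : Matrix A A ℂ),
      ∑ i, E i * (r • R) * (E i)ᴴ = r • ∑ i, E i * R * (E i)ᴴ := by
    intro r R
    simp [Finset.smul_sum]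
  -- scaling
  have hTS : ∀ c ∈ T, 0 < c → c⁻¹ ∈ S := by
    rintro c ⟨ρ, h1, h2, h3⟩ hc
    refine ⟨c⁻¹ • ρ, h1.smul (by positivity), by simp [Matrix.trace_smul, h2], ?_⟩
    have h4 : (c⁻¹ • (c • (1 : Matrix B B ℂ) - ∑ i, E i * ρ * (E i)ᴴ)).PosSemidef :=
      PosSemidef.smul h3 (by positivity)
    rw [smul_sub, smul_smul, inv_mul_cancel₀ hc.ne', one_smul, ← hlin] at h4
    exact h4
  have hST : ∀ x ∈ S, 0 < x → x⁻¹ ∈ T := by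
    rintro x ⟨R, h1, h2, h3⟩ hx
    have h5 : R.trace = (x : ℂ) := by
      have := (Complex.nonneg_iff.mp h1.trace_nonneg).2
      apply Complex.ext
      · simp [h2]
      · simp [← this]
    refine ⟨x⁻¹ • R, h1.smul (by positivity), ?_, ?_⟩
    · rw [Matrix.trace_smul, h5, Complex.real_smul, ← Complex.ofReal_mul,
        inv_mul_cancel₀ hx.ne', Complex.ofReal_one]
    have h4 : (x⁻¹ • ((1 : Matrix B B ℂ) - ∑ i, E i * R * (E i)ᴴ)).PosSemidef :=
      PosSemidef.smul h3 (by positivity)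
    rw [smul_sub, ← hlin] at h4
    exact h4
  -- uniform positive lower bound on T
  obtain ⟨δ, hδ, hδT⟩ : ∃ δ : ℝ, 0 < δ ∧ ∀ c ∈ T, δ ≤ c := by
    obtain ⟨a, ha⟩ := Finite.exists_min hpd.1.eigenvalues
    have hl := hpd.eigenvalues_pos a
    set l := hpd.1.eigenvalues a
    have hB : (0 : ℝ) < Fintype.card B := by exact_mod_cast Fintype.card_pos
    refine ⟨l / Fintype.card B, by positivity, ?_⟩
    rintro c ⟨ρ, h1, h2, h3⟩
    have h4 := aux_trace_s16 (aux_lower hpd.1 l ha) h1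
    have h5 : 0 ≤ (c • (1 : Matrix B B ℂ) - ∑ i, E i * ρ * (E i)ᴴ).trace :=
      PosSemidef.trace_nonneg h3
    have h6 : ((∑ i, (E i)ᴴ * E i) * ρ).trace = (∑ i, E i * ρ * (E i)ᴴ).trace := by
      rw [Finset.sum_mul, Matrix.trace_sum, Matrix.trace_sum]
      refine Finset.sum_congr rfl fun i _ => ?_
      rw [Matrix.mul_assoc, Matrix.trace_mul_comm]
    rw [Matrix.sub_mul, Matrix.trace_sub, h6] at h4
    rw [Matrix.trace_sub] at h5
    have h7 := add_nonneg h4 h5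
    rw [sub_add_sub_comm, add_comm, add_sub_add_right_eq_sub] at h7
    have h8 := (Complex.nonneg_iff.mp h7).1
    simp [Matrix.trace_smul, h2] at h8
    rw [div_le_iff₀ hB]
    exact h8
  have hTne : T.Nonempty := by
    set ρ : Matrix A A ℂ := ((Fintype.card A : ℝ)⁻¹) • (1 : Matrix A A ℂ) with hρ
    have h1 : ρ.PosSemidef := PosSemidef.one.smul (by positivity)
    have hN : (∑ i, E i * ρ * (E i)ᴴ).PosSemidef :=
      posSemidef_sum _ fun i _ => h1.mul_mul_conjTranspose_same _
    refine ⟨∑ j, hN.1.eigenvalues j, ρ, h1, by simp [hρ, Matrix.trace_smul], ?_⟩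
    refine aux_upper hN.1 _ fun i => ?_
    exact Finset.single_le_sum (fun j _ => hN.eigenvalues_nonneg j) (Finset.mem_univ i)
  have hTb : BddBelow T := ⟨δ, fun c hc => hδT c hc⟩
  have ht : 0 < sInf T := lt_of_lt_of_le hδ (le_csInf hTne hδT)
  have hSle : ∀ x ∈ S, x ≤ (sInf T)⁻¹ := by
    intro x hx
    rcases le_or_gt x 0 with h | h
    · exact h.trans (by positivity)
    · exact (le_inv_comm₀ ht h).mp (csInf_le hTb (hST x hx h))
  have hSb : BddAbove S := ⟨_, hSle⟩
  have hSne : S.Nonempty := by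
    obtain ⟨c, hc⟩ := hTne
    exact ⟨_, hTS c hc (hδ.trans_le (hδT c hc))⟩
  have hs : 0 < sSup S := by
    obtain ⟨c, hc⟩ := hTne
    have hc0 := hδ.trans_le (hδT c hc)
    exact (inv_pos.mpr hc0).trans_le (le_csSup hSb (hTS c hc hc0))
  have e1 : sSup S ≤ (sInf T)⁻¹ := csSup_le hSne hSle
  have e2 : (sSup S)⁻¹ ≤ sInf T := le_csInf hTne fun c hc => by
    have hc0 := hδ.trans_le (hδT c hc)
    exact (inv_le_comm₀ hs hc0).mpr (le_csSup hSb (hTS c hc hc0))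
  have e3 : sSup S = (sInf T)⁻¹ := le_antisymm e1 ((inv_le_comm₀ hs ht).mp e2)
  rw [e3, inv_mul_cancel₀ ht.ne']
end
end

section
/- Let α, β be real numbers with 0 < β < α and α² + β² = 1, and consider the cq-graph on input set Fin 2 with output space ℂ² given by the rank-one projections P₀ = [[α², αβ],[αβ, β²]] and P₁ = [[α², −αβ],[−αβ, β²]] (the projections onto ψ₀ = α·e₀ + β·e₁ and ψ₁ = α·e₀ − β·e₁). Then the one-shot no-signalling assisted independence number equals one: Υ({P₀, P₁}) = 1. -/
open Matrix BigOperators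
open scoped ComplexOrder

noncomputable section

variable {I B : Type*} [Fintype I] [Fintype B] [DecidableEq B]

lemma aux_psd (a g : ℝ) (h : a ^ 2 + g ^ 2 = 1) :
    ((1 : Matrix (Fin 2) (Fin 2) ℂ) -
      !![((a : ℂ) ^ 2), (a : ℂ) * (g : ℂ); (a : ℂ) * (g : ℂ), ((g : ℂ) ^ 2)]).PosSemidef := by
  have hc : (a : ℂ) ^ 2 + (g : ℂ) ^ 2 = 1 := by exact_mod_cast h
  have := Matrix.posSemidef_vecMulVec_self_star (![(g : ℂ), -(a : ℂ)])
  convert this using 1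
  ext i j
  fin_cases i <;> fin_cases j <;> simp [Matrix.vecMulVec] <;>
    first | (ring1) | linear_combination (-1 : ℂ) * hc | linear_combination hc

lemma aux_key (a g s : ℝ) (h : a ^ 2 + g ^ 2 = 1) (R T : Matrix (Fin 2) (Fin 2) ℂ)
    (hR : R.PosSemidef) (hT : T.PosSemidef)
    (hRT : R + T = s • ((1 : Matrix (Fin 2) (Fin 2) ℂ) -
      !![((a : ℂ) ^ 2), (a : ℂ) * (g : ℂ); (a : ℂ) * (g : ℂ), ((g : ℂ) ^ 2)])) :
    a ^ 2 * (T 0 0).re = g ^ 2 * (T 1 1).re := by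
  have hc : (a : ℂ) ^ 2 + (g : ℂ) ^ 2 = 1 := by exact_mod_cast h
  set v : Fin 2 → ℂ := ![(a : ℂ), (g : ℂ)] with hv
  have h1 := hR.dotProduct_mulVec_nonneg v
  have h2 := hT.dotProduct_mulVec_nonneg v
  have h3 : star v ⬝ᵥ (R *ᵥ v) + star v ⬝ᵥ (T *ᵥ v) = 0 := by
    have hz : ((1 : Matrix (Fin 2) (Fin 2) ℂ) -
      !![((a : ℂ) ^ 2), (a : ℂ) * (g : ℂ); (a : ℂ) * (g : ℂ), ((g : ℂ) ^ 2)]) *ᵥ v = 0 := by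
      ext i
      fin_cases i
      · simp [hv, Matrix.mulVec, dotProduct, Fin.sum_univ_two]
        linear_combination (-(a : ℂ)) * hc
      · simp [hv, Matrix.mulVec, dotProduct, Fin.sum_univ_two]
        linear_combination (-(g : ℂ)) * hc
    rw [← dotProduct_add, ← Matrix.add_mulVec, hRT, Matrix.smul_mulVec, hz]
    simp
  have h4 : star v ⬝ᵥ (T *ᵥ v) = 0 :=
    le_antisymm (by rw [← h3]; exact le_add_of_nonneg_left h1) h2
  have h5 := (hT.dotProduct_mulVec_zero_iff v).1 h4
  have e0 := congrArg Complex.re (congrFun h5 0)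
  have e1 := congrArg Complex.re (congrFun h5 1)
  have hh := congrArg Complex.re (hT.1.apply 0 1)
  simp [hv, Matrix.mulVec, dotProduct, Fin.sum_univ_two] at e0 e1 hh
  rw [hh] at e1
  linear_combination a * e0 - g * e1

/-- For the cq-graph of two pure states `ψ₀ = α e₀ + β e₁`, `ψ₁ = α e₀ - β e₁`
with `0 < β < α`, the one-shot no-signalling assisted independence number is `1`. -/
theorem two_pure_states_upsilon_eq_one (α β : ℝ) (hβ : 0 < β) (hβα : β < α)
    (hnorm : α ^ 2 + β ^ 2 = 1) :
    UpsilonCQ (![!![((α : ℂ) ^ 2), (α : ℂ) * (β : ℂ); (α : ℂ) * (β : ℂ), ((β : ℂ) ^ 2)],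
                 !![((α : ℂ) ^ 2), -((α : ℂ) * (β : ℂ));
                    -((α : ℂ) * (β : ℂ)), ((β : ℂ) ^ 2)]]) = 1 := by
  have hn' : α ^ 2 + (-β) ^ 2 = 1 := by rw [neg_sq]; exact hnorm
  have p0 := aux_psd α β hnorm
  have p1 := aux_psd α (-β) hn'
  have k0 := aux_key α β
  have k1 := aux_key α (-β)
  simp only [Complex.ofReal_neg, mul_neg, neg_sq] at p1 k1
  unfold UpsilonCQ
  refine Eq.trans (congrArg sSup ?_) (csSup_singleton (1 : ℝ))
  ext x
  simp only [Set.mem_setOf_eq, Set.mem_singleton_iff, loe, Fin.sum_univ_two, Fin.forall_fin_two,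
    Matrix.cons_val_zero, Matrix.cons_val_one, sub_zero]
  constructor
  · rintro ⟨s, -, rfl, R, ⟨⟨r0, t0⟩, r1, t1⟩, hs⟩
    have a0 := k0 (s 0) hnorm _ _ r0 t0 (by abel)
    have a1 := k1 (s 1) hnorm _ _ r1 t1 (by abel)
    have b0 := congrArg Complex.re (congrFun (congrFun hs 0) 0)
    have b1 := congrArg Complex.re (congrFun (congrFun hs 1) 1)
    simp [← Complex.ofReal_pow] at a0 a1 b0 b1
    have hne : α ^ 2 - β ^ 2 ≠ 0 := by nlinarith
    have : (α ^ 2 - β ^ 2) * (s 0 + s 1 - 1) = 0 := by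
      linear_combination a0 + a1 + α ^ 2 * b0 - β ^ 2 * b1
    have := (mul_eq_zero.1 this).resolve_left hne
    linarith
  · rintro rfl
    refine ⟨fun _ => 1 / 2, by norm_num, by norm_num,
      ![(1 / 2 : ℝ) • (1 - !![((α : ℂ) ^ 2), (α : ℂ) * (β : ℂ); (α : ℂ) * (β : ℂ), ((β : ℂ) ^ 2)]),
        (1 / 2 : ℝ) • (1 - !![((α : ℂ) ^ 2), -((α : ℂ) * (β : ℂ));
                    -((α : ℂ) * (β : ℂ)), ((β : ℂ) ^ 2)])], ⟨⟨?_, ?_⟩, ?_, ?_⟩, ?_⟩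
    · exact p0.smul (by norm_num)
    · simpa using Matrix.PosSemidef.zero
    · exact p1.smul (by norm_num)
    · simpa using Matrix.PosSemidef.zero
    · simp only [Matrix.cons_val_zero, Matrix.cons_val_one, ← smul_add, add_sub_cancel]
      rw [smul_add, ← add_smul]
      norm_num
end
end
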